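/- arXiv:2001.04728 — 3 statements merged into one kernel-verified Lean document; each statement's English description precedes it below -/
import Mathlib

section
/- Let D be a nontrivial 2-(v,k,2) design and let G ≤ Aut(D) be flag-transitive. If G is point-imprimitive, i.e. G leaves invariant a partition of the point set P with more than one part and with some part of size greater than one, then v = 16, k = 6 and D is symmetric (it has exactly 16 blocks). -/
/-- The set `Bs` of blocks forms a `2`-`(v, k, lam)` design on the point set `P`:
there are `v` points, every block is a `k`-element subset of `P`, and any two
distinct points lie in exactly `lam` common blocks. -/
def IsTwoDesign (v k lam : ℕ) (P : Type*) (Bs : Set (Set P)) : Prop :=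
  Nat.card P = v ∧
  (∀ B ∈ Bs, Nat.card B = k) ∧
  ∀ x y : P, x ≠ y → Nat.card {B : Set P | B ∈ Bs ∧ x ∈ B ∧ y ∈ B} = lam

/-- Every element of `G` is an automorphism of the design with block set `Bs`. -/
def IsAutomGroup {P : Type*} (G : Subgroup (Equiv.Perm P)) (Bs : Set (Set P)) : Prop :=
  ∀ g ∈ G, ∀ B ∈ Bs, (⇑g) '' B ∈ Bs

/-- `G` is transitive on the flags (incident point-block pairs) of the design. -/
def IsFlagTransitive {P : Type*} (G : Subgroup (Equiv.Perm P)) (Bs : Set (Set P)) : Prop :=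
  ∀ B₁ ∈ Bs, ∀ B₂ ∈ Bs, ∀ x₁ ∈ B₁, ∀ x₂ ∈ B₂,
    ∃ g ∈ G, (⇑g) '' B₁ = B₂ ∧ g x₁ = x₂

/-- `C` is a partition of `P` into nonempty parts. -/
def IsPartitionOn (P : Type*) (C : Set (Set P)) : Prop :=
  (∀ Δ ∈ C, Δ.Nonempty) ∧ ∀ x : P, ∃! Δ : Set P, Δ ∈ C ∧ x ∈ Δ

/-- `C` is a `G`-invariant partition of the point set. -/
def IsInvariantPartition {P : Type*} (G : Subgroup (Equiv.Perm P)) (C : Set (Set P)) : Prop :=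
  IsPartitionOn P C ∧ ∀ g ∈ G, ∀ Δ ∈ C, (⇑g) '' Δ ∈ C

theorem parameters_of_equations {r k l s v c d b : ℕ} (hc : 2 ≤ c) (hd : 2 ≤ d) (hl : 1 ≤ l)
    (hk : k = l * s) (hk0 : 0 < k) (hv : v = c * d) (h₁ : r * (k - 1) = 2 * (v - 1))
    (h₂ : r * (l - 1) = 2 * (c - 1)) (h₃ : b * k = v * r) (h₄ : v ≤ b) :
    l = 2 ∧ d = c ∧ k = c + 2 ∧ r = 2 * (c - 1) ∧ (c = 4 ∨ c = 6 ∨ c = 10 ∨ c = 22) := by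
  obtain ⟨m, rfl⟩ := Nat.exists_eq_add_of_le' hl
  obtain ⟨e, rfl⟩ := Nat.exists_eq_add_of_le' (by omega : 1 ≤ c)
  obtain ⟨f, rfl⟩ := Nat.exists_eq_add_of_le' (by omega : 1 ≤ d)
  obtain ⟨u, rfl⟩ : ∃ u, s = u + 1 := by
    refine Nat.exists_eq_add_of_le' (Nat.one_le_iff_ne_zero.2 ?_)
    rintro rfl
    omega
  have hkr : k ≤ r := by
    have hv0 : 0 < v := by rw [hv]; positivity
    refine Nat.le_of_mul_le_mul_left (?_ : v * k ≤ v * r) hv0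
    rw [← h₃]
    exact Nat.mul_le_mul_right _ h₄
  have hk1 : k - 1 = m + (m + 1) * u := by
    rw [hk, mul_add, mul_one]; omega
  have hv1 : v - 1 = e + (e + 1) * f := by
    rw [hv, mul_add, mul_one]; omega
  rw [hk1, hv1] at h₁
  simp only [Nat.add_sub_cancel] at h₂ ⊢
  have h₅ : r * ((m + 1) * u) = (r * m + 2) * f := by nlinarith
  obtain ⟨y, hy⟩ : r ∣ 2 * f := by
    have : r ∣ r * m * f + 2 * f := ⟨(m + 1) * u, by rw [h₅]; ring⟩
    exact (Nat.dvd_add_right ⟨m * f, by ring⟩).1 this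
  have hr0 : 0 < r := by omega
  have h₆ : (r * m + 2) * y = 2 * ((m + 1) * u) := by
    refine Nat.eq_of_mul_eq_mul_left hr0 ?_
    calc r * ((r * m + 2) * y) = (r * m + 2) * (r * y) := by ring
      _ = 2 * ((r * m + 2) * f) := by rw [← hy]; ring
      _ = r * (2 * ((m + 1) * u)) := by rw [← h₅]; ring
  have hy0 : 0 < y := Nat.pos_of_ne_zero fun h => by subst h; omega
  have hm0 : 0 < m := Nat.pos_of_ne_zero fun h => by subst h; omega
  have h₇ : m * y < 2 := by
    by_contra! hcon
    have h8 : (m + 1) * (u + 1) * (m * y) ≤ r * (m * y) :=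
      Nat.mul_le_mul_right _ (hk ▸ hkr)
    have h9 : (m + 1) * (u + 1) * 2 ≤ (m + 1) * (u + 1) * (m * y) := Nat.mul_le_mul_left _ hcon
    nlinarith
  have hmy : m = 1 ∧ y = 1 := by
    have : m * y = 1 := by have := Nat.mul_pos hm0 hy0; omega
    exact ⟨Nat.eq_one_of_mul_eq_one_right this, Nat.eq_one_of_mul_eq_one_left this⟩
  obtain ⟨rfl, rfl⟩ := hmy
  have hf : f = e := by omega
  have he : e + 1 = 2 * u := by omega
  have hr : r = 2 * e := by omega
  refine ⟨rfl, by omega, by omega, by omega, ?_⟩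
  have hdvd : u + 1 ∣ 12 := by
    have h8 : (u + 1 : ℤ) ∣ 12 := by
      refine ⟨8 * u ^ 2 - 12 * u + 12 - b, ?_⟩
      have he' : (e : ℤ) = 2 * u - 1 := by omega
      have h9 : (b : ℤ) * ((1 + 1) * (u + 1)) = (e + 1) * (e + 1) * (2 * e) := by
        have := h₃
        rw [hk, hv, hf, hr] at this
        exact_mod_cast this
      rw [he'] at h9
      linarith
    exact_mod_cast h8
  have hu : u ≤ 11 := by have := Nat.le_of_dvd (by norm_num) hdvd; omega
  interval_cases u <;> omega

section Designs

open Finset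

open scoped Classical

variable {G P Q T : Type*} [Group G] [Fintype P] [Fintype Q] [Fintype T]
  [MulAction G P] [MulAction G Q] [MulAction G T]

theorem sum_sum_pts {P T R : Type*} [Fintype P] [Fintype T] [CommSemiring R] (pts : T → Finset P)
    (F : P → P → R) : ∑ t, ∑ x ∈ pts t, ∑ y ∈ pts t, F x y
      = ∑ x, ∑ y, F x y * (#{t | x ∈ pts t ∧ y ∈ pts t} : R) := by
  have e : ∀ t, ∑ x ∈ pts t, ∑ y ∈ pts t, F x y
      = ∑ x, ∑ y, if x ∈ pts t ∧ y ∈ pts t then F x y else 0 := fun t => by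
    simp only [ite_and, sum_ite_irrel, sum_const_zero, sum_ite_mem, univ_inter]
  simp only [e]
  rw [sum_comm]
  refine sum_congr rfl fun x _ => ?_
  rw [sum_comm]
  refine sum_congr rfl fun y _ => ?_
  rw [← sum_filter, sum_const, nsmul_eq_mul, mul_comm]

/-- A flag-transitive action of `G` on a `2`-`(|P|, k, 2)` design with blocks `T`, together with a
nontrivial `G`-invariant partition of the points, given as the fibres of `π`. -/
structure IsFlagTransitiveImprimitive (G : Type*) {P Q T : Type*} [Group G] [Fintype P] [Fintype Q]
    [Fintype T] [MulAction G P] [MulAction G Q] [MulAction G T]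
    (π : P → Q) (pts : T → Finset P) (k : ℕ) : Prop where
  map_smul : ∀ (g : G) (x : P), π (g • x) = g • π x
  smul_mem : ∀ (g : G) (x : P) (t : T), x ∈ pts t → g • x ∈ pts (g • t)
  flag : ∀ t t' x x', x ∈ pts t → x' ∈ pts t' → ∃ g : G, g • t = t' ∧ g • x = x'
  card_pts : ∀ t, #(pts t) = k
  card_two : ∀ x y, x ≠ y → #{t | x ∈ pts t ∧ y ∈ pts t} = 2
  surj : Function.Surjective π
  two_lt : 2 < k
  lt_card : k < Fintype.card P
  exists_ne : ∃ x y, π x ≠ π y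
  exists_eq : ∃ x y, x ≠ y ∧ π x = π y

namespace IsFlagTransitiveImprimitive

variable {π : P → Q} {pts : T → Finset P} {k : ℕ}

theorem smul_mem_iff (h : IsFlagTransitiveImprimitive G π pts k) (g : G) (x : P) (t : T) :
    g • x ∈ pts (g • t) ↔ x ∈ pts t := by
  refine ⟨fun hx => ?_, h.smul_mem g x t⟩
  simpa using h.smul_mem g⁻¹ _ _ hx

theorem smul_pts (h : IsFlagTransitiveImprimitive G π pts k) (g : G) (t : T) :
    pts (g • t) = (pts t).map (MulAction.toPerm g).toEmbedding := by
  ext x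
  simp only [mem_map_equiv, MulAction.toPerm_symm_apply]
  rw [← h.smul_mem_iff g⁻¹, inv_smul_smul]

/-- Counting pairs `(y, t)` with `y ∈ Y` and `t` a block containing `x` and `y`. -/
theorem sum_card_inter (h : IsFlagTransitiveImprimitive G π pts k) {x : P} {Y : Finset P}
    (hx : x ∉ Y) : ∑ t with x ∈ pts t, #(pts t ∩ Y) = 2 * #Y := by
  have := sum_card_bipartiteAbove_eq_sum_card_bipartiteBelow (fun (t : T) (y : P) => y ∈ pts t)
    (s := ({t | x ∈ pts t} : Finset T)) (t := Y)
  simp only [bipartiteAbove, bipartiteBelow] at this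
  have e : ∀ y ∈ Y, #{t ∈ ({t | x ∈ pts t} : Finset T) | y ∈ pts t} = 2 := fun y hy => by
    rw [filter_filter]
    exact h.card_two x y fun e => hx (e ▸ hy)
  rw [sum_congr rfl e, sum_const, smul_eq_mul, mul_comm] at this
  rw [← this]
  refine sum_congr rfl fun t _ => ?_
  congr 1
  ext y
  simp [and_comm]

theorem exists_block (h : IsFlagTransitiveImprimitive G π pts k) {x y : P} (hxy : x ≠ y) :
    ∃ t, x ∈ pts t ∧ y ∈ pts t := by
  have : 0 < #{t | x ∈ pts t ∧ y ∈ pts t} := by rw [h.card_two x y hxy]; norm_num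
  obtain ⟨t, ht⟩ := card_pos.1 this
  exact ⟨t, by simpa using ht⟩

theorem exists_ne_point (h : IsFlagTransitiveImprimitive G π pts k) (x : P) : ∃ y, x ≠ y := by
  have := h.lt_card
  have := h.two_lt
  have : 1 < Fintype.card P := by omega
  obtain ⟨y, hy⟩ := Fintype.exists_ne_of_one_lt_card this x
  exact ⟨y, hy.symm⟩

theorem exists_block_mem (h : IsFlagTransitiveImprimitive G π pts k) (x : P) :
    ∃ t, x ∈ pts t := by
  obtain ⟨y, hy⟩ := h.exists_ne_point x
  obtain ⟨t, ht⟩ := h.exists_block hy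
  exact ⟨t, ht.1⟩

theorem exists_smul_eq (h : IsFlagTransitiveImprimitive G π pts k) (x y : P) :
    ∃ g : G, g • x = y := by
  obtain ⟨t, ht⟩ := h.exists_block_mem x
  obtain ⟨t', ht'⟩ := h.exists_block_mem y
  obtain ⟨g, -, hg⟩ := h.flag t t' x y ht ht'
  exact ⟨g, hg⟩

theorem degree_mul (h : IsFlagTransitiveImprimitive G π pts k) (x : P) :
    #{t | x ∈ pts t} * (k - 1) = 2 * (Fintype.card P - 1) := by
  have := h.sum_card_inter (x := x) (Y := univ.erase x) (by simp)
  rw [sum_congr rfl (g := fun _ => k - 1), sum_const, smul_eq_mul] at this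
  · rw [this, card_erase_of_mem (mem_univ _), card_univ]
  · intro t ht
    rw [inter_erase, inter_univ, card_erase_of_mem (by simpa using ht), h.card_pts]

theorem exists_degree (h : IsFlagTransitiveImprimitive G π pts k) :
    ∃ r, ∀ x, #{t | x ∈ pts t} = r := by
  obtain ⟨x₀, -⟩ := h.exists_ne
  refine ⟨#{t | x₀ ∈ pts t}, fun x => ?_⟩
  have h1 := h.degree_mul x
  have h2 := h.degree_mul x₀
  have := h.two_lt
  exact Nat.eq_of_mul_eq_mul_right (by omega : 0 < k - 1) (h1.trans h2.symm)

theorem exists_card_inter_class (h : IsFlagTransitiveImprimitive G π pts k) :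
    ∃ l, ∀ x t, x ∈ pts t → #{y ∈ pts t | π y = π x} = l := by
  obtain ⟨x₀, -⟩ := h.exists_ne
  obtain ⟨t₀, ht₀⟩ := h.exists_block_mem x₀
  refine ⟨#{y ∈ pts t₀ | π y = π x₀}, fun x t hx => ?_⟩
  obtain ⟨g, rfl, rfl⟩ := h.flag t₀ t x₀ x ht₀ hx
  rw [h.smul_pts, filter_map, card_map]
  congr 1
  ext y
  simp [h.map_smul]

theorem class_mul (h : IsFlagTransitiveImprimitive G π pts k) {r l : ℕ}
    (hr : ∀ x, #{t | x ∈ pts t} = r)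
    (hl : ∀ x t, x ∈ pts t → #{y ∈ pts t | π y = π x} = l) (x : P) :
    r * (l - 1) = 2 * (#{y | π y = π x} - 1) := by
  have := h.sum_card_inter (x := x) (Y := ({y | π y = π x} : Finset P).erase x) (by simp)
  rw [sum_congr rfl (g := fun _ => l - 1), sum_const, smul_eq_mul, hr] at this
  · rw [this, card_erase_of_mem (by simp)]
  · intro t ht
    have ht : x ∈ pts t := by simpa using ht
    rw [inter_erase, card_erase_of_mem (by simp [ht]), ← hl x t ht]
    congr 2
    ext y
    simp

theorem card_mul_eq (h : IsFlagTransitiveImprimitive G π pts k) {r : ℕ}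
    (hr : ∀ x, #{t | x ∈ pts t} = r) : Fintype.card T * k = Fintype.card P * r := by
  have := sum_card_bipartiteAbove_eq_sum_card_bipartiteBelow (fun (t : T) (y : P) => y ∈ pts t)
    (s := univ) (t := univ)
  simp only [bipartiteAbove, bipartiteBelow, hr, sum_const, smul_eq_mul, card_univ] at this
  rw [← this, sum_congr rfl (g := fun _ => k)]
  · simp
  · intro t _
    rw [← h.card_pts t]
    congr 1
    ext
    simp

/-- Fisher's inequality. -/
theorem card_points_le_card_blocks (h : IsFlagTransitiveImprimitive G π pts k) :
    Fintype.card P ≤ Fintype.card T := by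
  obtain ⟨r, hr⟩ := h.exists_degree
  have hr2 : 2 < r := by
    obtain ⟨x₀, -⟩ := h.exists_ne
    have h1 := h.degree_mul x₀
    rw [hr] at h1
    have := h.two_lt
    have := h.lt_card
    by_contra hcon
    have : r * (k - 1) ≤ 2 * (k - 1) := Nat.mul_le_mul_right _ (by omega)
    omega
  let φ : (P → ℚ) →ₗ[ℚ] (T → ℚ) :=
    { toFun := fun f t => ∑ x ∈ pts t, f x
      map_add' := fun f g => by ext t; simp [sum_add_distrib]
      map_smul' := fun c f => by ext t; simp [mul_sum] }
  have hφ : Function.Injective φ := by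
    rw [← LinearMap.ker_eq_bot, LinearMap.ker_eq_bot']
    intro f hf
    have h0 : ∀ t, ∑ x ∈ pts t, f x = 0 := fun t => congrFun hf t
    have h1 : ∑ t, (∑ x ∈ pts t, f x) * (∑ y ∈ pts t, f y)
        = ∑ x, ∑ y, f x * f y * (#{t | x ∈ pts t ∧ y ∈ pts t} : ℚ) := by
      simp only [sum_mul_sum]
      exact sum_sum_pts pts fun x y => f x * f y
    have h2 : ∀ x, ∑ y, f x * f y * (#{t | x ∈ pts t ∧ y ∈ pts t} : ℚ)
        = 2 * (f x * ∑ y, f y) + (r - 2) * (f x * f x) := by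
      intro x
      have e : ∀ y, f x * f y * (#{t | x ∈ pts t ∧ y ∈ pts t} : ℚ)
          = 2 * (f x * f y) + if y = x then (r - 2) * (f x * f y) else 0 := by
        intro y
        split_ifs with hy
        · subst hy
          simp only [and_self, hr]
          ring
        · rw [h.card_two x y (Ne.symm hy)]
          push_cast
          ring
      rw [sum_congr rfl fun y _ => e y, sum_add_distrib, ← mul_sum, ← mul_sum]
      simp
    simp only [h0, h2, mul_zero, sum_const_zero, sum_add_distrib, ← mul_sum, ← sum_mul] at h1
    have hr2' : (2 : ℚ) < r := by exact_mod_cast hr2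
    have h3 : ∑ x, f x * f x = 0 := by
      have a := mul_self_nonneg (∑ x, f x)
      have b : 0 ≤ ∑ x, f x * f x := sum_nonneg fun x _ => mul_self_nonneg _
      nlinarith
    ext x
    have := (sum_eq_zero_iff_of_nonneg fun x _ => mul_self_nonneg (f x)).1 h3 x (mem_univ x)
    simpa using this
  simpa using LinearMap.finrank_le_finrank_of_injective hφ

end IsFlagTransitiveImprimitive

theorem card_block_eq {P Q T : Type*} {π : P → Q} {pts : T → Finset P} {l : ℕ}
    (hl : ∀ x t, x ∈ pts t → #{y ∈ pts t | π y = π x} = l) (t : T) :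
    #(pts t) = l * #((pts t).image π) := by
  rw [card_eq_sum_card_image π, sum_congr rfl (g := fun _ => l), sum_const, smul_eq_mul, mul_comm]
  intro q hq
  obtain ⟨x, hx, rfl⟩ := mem_image.1 hq
  exact hl x t hx

/-- The numerical parameters of a flag-transitive imprimitive design with `λ = 2`. -/
structure HasParameters {P Q T : Type*} [Fintype P] [Fintype Q] [Fintype T]
    (π : P → Q) (pts : T → Finset P) (k c : ℕ) : Prop where
  card_classes : Fintype.card Q = c
  card_class : ∀ q, #{x | π x = q} = c
  card_inter : ∀ x t, x ∈ pts t → #{y ∈ pts t | π y = π x} = 2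
  degree : ∀ x, #{t | x ∈ pts t} = 2 * (c - 1)
  block_size : k = c + 2
  card_blocks : Fintype.card T * (c + 2) = c * c * (2 * (c - 1))

namespace IsFlagTransitiveImprimitive

variable {π : P → Q} {pts : T → Finset P} {k c : ℕ}

theorem hasParameters (h : IsFlagTransitiveImprimitive G π pts k) :
    ∃ c, HasParameters π pts k c ∧ (c = 4 ∨ c = 6 ∨ c = 10 ∨ c = 22) := by
  obtain ⟨r, hr⟩ := h.exists_degree
  obtain ⟨l, hl⟩ := h.exists_card_inter_class
  obtain ⟨x₀, y₀, hxy, hπ⟩ := h.exists_eq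
  obtain ⟨x₁, y₁, hne⟩ := h.exists_ne
  obtain ⟨t₀, hx₀, -⟩ := h.exists_block hxy
  have hcl := h.class_mul hr hl
  have hpos : ∀ x, 0 < #{y | π y = π x} := fun x => card_pos.2 ⟨x, by simp⟩
  set c := #{y | π y = π x₀} with hc
  have hclass : ∀ q, #{x | π x = q} = c := fun q => by
    obtain ⟨x, rfl⟩ := h.surj q
    have h1 := hcl x
    have h2 := hcl x₀
    have := hpos x
    have := hpos x₀
    omega
  have hc2 : 2 ≤ c := one_lt_card.2 ⟨x₀, by simp, y₀, by simp [hπ], hxy⟩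
  have hd2 : 2 ≤ Fintype.card Q := Fintype.one_lt_card_iff.2 ⟨_, _, hne⟩
  have hl1 : 1 ≤ l := by
    rw [← hl x₀ t₀ hx₀]
    exact card_pos.2 ⟨x₀, by simp [hx₀]⟩
  have hk : k = l * #((pts t₀).image π) := by rw [← h.card_pts t₀]; exact card_block_eq hl t₀
  have hv : Fintype.card P = c * Fintype.card Q := by
    rw [← card_univ, card_eq_sum_card_fiberwise (f := π) (t := univ) (by simp),
      sum_congr rfl fun q _ => hclass q, sum_const, smul_eq_mul, card_univ, mul_comm]
  have hk0 := h.two_lt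
  have h1 := h.degree_mul x₀
  rw [hr] at h1
  have hT := h.card_mul_eq hr
  obtain ⟨rfl, hd, hk', hr', hcs⟩ := parameters_of_equations hc2 hd2 hl1 hk (by omega) hv h1
    (hcl x₀) hT h.card_points_le_card_blocks
  refine ⟨c, ⟨hd, hclass, hl, hr' ▸ hr, hk', ?_⟩, hcs⟩
  rw [← hk', hT, hv, hd, hr']

/-- The stabiliser of a point is transitive on the other points of its class. -/
theorem exists_smul_eq_of_map_eq (h : IsFlagTransitiveImprimitive G π pts k)
    (hp : HasParameters π pts k c) {x y z : P} (hy : π y = π x) (hz : π z = π x) (hxy : x ≠ y)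
    (hxz : x ≠ z) : ∃ g : G, g • x = x ∧ g • y = z := by
  obtain ⟨t, hxt, hyt⟩ := h.exists_block hxy
  obtain ⟨t', hxt', hzt'⟩ := h.exists_block hxz
  obtain ⟨g, rfl, hg⟩ := h.flag t t' x x hxt hxt'
  refine ⟨g, hg, ?_⟩
  have hgy : π (g • y) = π x := by rw [h.map_smul, hy, ← h.map_smul, hg]
  have hne : x ≠ g • y := fun e => hxy (MulAction.injective g (hg.trans e))
  by_contra hcon
  have h3 : #{x, g • y, z} = 3 := card_eq_three.2 ⟨_, _, _, hne, hxz, hcon, rfl⟩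
  have h2 := hp.card_inter x _ hxt'
  have : ({x, g • y, z} : Finset P) ⊆ {w ∈ pts (g • t) | π w = π x} := by
    intro w hw
    simp only [mem_insert, mem_singleton] at hw
    rcases hw with rfl | rfl | rfl
    · simpa using hxt'
    · simpa using ⟨h.smul_mem g y t hyt, hgy⟩
    · simpa using ⟨hzt', hz⟩
  have := card_le_card this
  omega

/-- The stabiliser of a point is transitive on the classes not containing it. -/
theorem exists_smul_map_eq (h : IsFlagTransitiveImprimitive G π pts k)
    (hp : HasParameters π pts k c) (hc : 2 ≤ c) {x : P} {q q' : Q} (hq : q ≠ π x) (hq' : q' ≠ π x) :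
    ∃ g : G, g • x = x ∧ g • q = q' := by
  let M : Finset Q := {w | ∃ g : G, g • x = x ∧ g • q = w}
  let Y : Finset P := {y | π y ∈ M}
  have hinv : ∀ g : G, g • x = x → ∀ y ∈ Y, g • y ∈ Y := by
    intro g hg y hy
    simp only [Y, M, mem_filter, mem_univ, true_and] at hy ⊢
    obtain ⟨a, ha, haq⟩ := hy
    exact ⟨g * a, by rw [mul_smul, ha, hg], by rw [mul_smul, haq, h.map_smul]⟩
  have hfix : ∀ g : G, g • x = x → g • π x = π x := fun g hg => by rw [← h.map_smul, hg]
  have hMx : π x ∉ M := by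
    simp only [M, mem_filter, mem_univ, true_and, not_exists, not_and]
    intro g hg e
    exact hq (MulAction.injective g (e.trans (hfix g hg).symm))
  have hxY : x ∉ Y := by simpa [Y] using hMx
  obtain ⟨t₀, ht₀⟩ := h.exists_block_mem x
  have hconst : ∀ t ∈ ({t | x ∈ pts t} : Finset T), #(pts t ∩ Y) = #(pts t₀ ∩ Y) := by
    intro t ht
    obtain ⟨g, rfl, hg⟩ := h.flag t₀ t x x ht₀ (by simpa using ht)
    rw [← card_map (MulAction.toPerm g).toEmbedding (s := pts t₀ ∩ Y)]
    congr 1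
    rw [map_inter, ← h.smul_pts]
    congr 1
    ext y
    simp only [mem_map_equiv, MulAction.toPerm_symm_apply]
    refine ⟨fun hy => hinv g⁻¹ (inv_smul_eq_iff.2 hg.symm) y hy, fun hy => ?_⟩
    simpa using hinv g hg _ hy
  have hsum := h.sum_card_inter hxY
  rw [sum_congr rfl hconst, sum_const, smul_eq_mul, hp.degree] at hsum
  have hY : #Y = #M * c := by
    rw [card_eq_sum_card_fiberwise (f := π) (t := M) (by intro y; simp [Y]),
      sum_congr rfl (g := fun _ => c),
      sum_const, smul_eq_mul]
    intro w hw
    rw [← hp.card_class w]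
    congr 1
    ext y
    simp only [Y, mem_filter, mem_univ, true_and, and_iff_right_iff_imp]
    rintro rfl
    exact hw
  have hdvd : c - 1 ∣ #M := by
    have h1 : c - 1 ∣ #M * c := ⟨#(pts t₀ ∩ Y), by rw [← hY]; linarith⟩
    refine Nat.Coprime.dvd_of_dvd_mul_right ?_ h1
    exact (Nat.coprime_self_sub_left (by omega)).2 (by simp)
  have hM : M ⊆ univ.erase (π x) := fun w hw => by
    simp only [mem_erase, mem_univ, and_true]
    rintro rfl
    exact hMx hw
  have hMpos : 0 < #M := card_pos.2 ⟨q, by simpa [M] using ⟨1, by simp⟩⟩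
  have hMeq : M = univ.erase (π x) := by
    refine eq_of_subset_of_card_le hM ?_
    rw [card_erase_of_mem (mem_univ _), card_univ, hp.card_classes]
    exact Nat.le_of_dvd hMpos hdvd
  have : q' ∈ M := by rw [hMeq]; simpa using hq'
  simpa [M] using this

end IsFlagTransitiveImprimitive

section OddOrder

variable {H α : Type*} [Group H] [MulAction H α]

theorem smul_eq_of_odd_orderOf {g : H} (hg : Odd (orderOf g)) {a : α} (h : g • g • a = a) :
    g • a = a := by
  obtain ⟨n, hn⟩ := hg
  have h1 : (g ^ 2) • a = a := by rw [pow_two, mul_smul, h]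
  have h2 : g = (g ^ 2) ^ (n + 1) := by
    rw [← pow_mul, show 2 * (n + 1) = orderOf g + 1 by omega, pow_succ, pow_orderOf_eq_one,
      one_mul]
  have h3 : ∀ m : ℕ, (g ^ 2) ^ m • a = a := fun m => by
    induction m with
    | zero => simp
    | succ m ih => rw [pow_succ, mul_smul, h1, ih]
  rw [h2, h3]

/-- An element of odd order fixes every point of an invariant set with two elements. -/
theorem smul_eq_of_card_eq_two {g : H} (hg : Odd (orderOf g)) {S : Finset α} (hS : #S = 2)
    (hinv : ∀ a ∈ S, g • a ∈ S) {a : α} (ha : a ∈ S) : g • a = a := by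
  by_contra hne
  refine hne (smul_eq_of_odd_orderOf hg ?_)
  by_contra hne'
  have h1 : g • g • a ≠ g • a := fun e => hne (MulAction.injective g e)
  have h3 : #{a, g • a, g • g • a} = 3 :=
    card_eq_three.2 ⟨_, _, _, Ne.symm hne, Ne.symm hne', Ne.symm h1, rfl⟩
  have := card_le_card (show {a, g • a, g • g • a} ⊆ S by
    intro w hw
    simp only [mem_insert, mem_singleton] at hw
    rcases hw with rfl | rfl | rfl
    exacts [ha, hinv _ ha, hinv _ (hinv _ ha)])
  omega

end OddOrder

namespace IsFlagTransitiveImprimitive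

variable {π : P → Q} {pts : T → Finset P} {k c : ℕ}

/-- An element of odd order fixing every class and two points is trivial. -/
theorem eq_one_of_odd_of_fixes_two [FaithfulSMul G P] (h : IsFlagTransitiveImprimitive G π pts k)
    (hp : HasParameters π pts k c) {g : G} (hg : Odd (orderOf g)) (hgQ : ∀ q : Q, g • q = q)
    {x y : P} (hxy : x ≠ y) (hx : g • x = x) (hy : g • y = y) : g = 1 := by
  have hblock : ∀ {x y : P}, x ≠ y → g • x = x → g • y = y → ∀ t, x ∈ pts t → y ∈ pts t →
      g • t = t := by
    intro x y hxy hx hy t hxt hyt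
    refine smul_eq_of_card_eq_two hg (h.card_two x y hxy) ?_ (by simp [hxt, hyt])
    intro t ht
    simp only [mem_filter, mem_univ, true_and] at ht ⊢
    have h1 := h.smul_mem g x t ht.1
    have h2 := h.smul_mem g y t ht.2
    rw [hx] at h1
    rw [hy] at h2
    exact ⟨h1, h2⟩
  have hpoint : ∀ {t}, g • t = t → ∀ z ∈ pts t, g • z = z := by
    intro t ht z hz
    refine smul_eq_of_card_eq_two hg (hp.card_inter z t hz) ?_ (by simp [hz])
    intro w hw
    simp only [mem_filter] at hw ⊢
    refine ⟨?_, by rw [h.map_smul, hgQ, hw.2]⟩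
    have := h.smul_mem g w t hw.1
    rwa [ht] at this
  have hall : ∀ z : P, g • z = z := by
    by_contra! hcon
    obtain ⟨z, hz⟩ := hcon
    let F : Finset P := {w | g • w = w}
    obtain ⟨t, hxt, hyt⟩ := h.exists_block hxy
    have hF : k ≤ #F := by
      rw [← h.card_pts t]
      refine card_le_card fun w hw => ?_
      simpa [F] using hpoint (hblock hxy hx hy t hxt hyt) w hw
    have hsum := h.sum_card_inter (x := z) (Y := F) (by simpa [F] using hz)
    have hle : ∑ t with z ∈ pts t, #(pts t ∩ F) ≤ ∑ t with z ∈ pts t, 1 := by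
      refine sum_le_sum fun s hs => ?_
      have hs : z ∈ pts s := by simpa using hs
      rw [card_le_one]
      intro a ha b hb
      by_contra hab
      simp only [F, mem_inter, mem_filter, mem_univ, true_and] at ha hb
      exact hz (hpoint (hblock hab ha.2 hb.2 s ha.1 hb.1) z hs)
    rw [hsum, sum_const, smul_eq_mul, hp.degree] at hle
    have := hp.block_size
    omega
  exact FaithfulSMul.eq_of_smul_eq_smul fun z : P => by rw [hall, one_smul]

/-- An element of odd prime order fixing every class has no fixed point. -/
theorem smul_ne_of_orderOf_prime [FaithfulSMul G P] (h : IsFlagTransitiveImprimitive G π pts k)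
    (hp : HasParameters π pts k c) {q : ℕ} (hq : q.Prime) (hq2 : q ≠ 2) {g : G}
    (hg : orderOf g = q) (hgQ : ∀ w : Q, g • w = w) (x : P) : g • x ≠ x := by
  intro hx
  have := Fact.mk hq
  have hodd : Odd (orderOf g) := hg ▸ hq.odd_of_ne_two hq2
  have huniq : ∀ y, g • y = y → y = x := by
    intro y hy
    by_contra hne
    have := h.eq_one_of_odd_of_fixes_two hp hodd hgQ hne hy hx
    rw [this, orderOf_one] at hg
    exact hq.one_lt.ne hg
  have key : ∀ w : Q, c ≡ #{y | π y = w ∧ g • y = y} [MOD q] := by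
    intro w
    let f : Function.End {y // π y = w} := fun y => ⟨g • y.1, by rw [h.map_smul, y.2, hgQ]⟩
    have hfn : ∀ n : ℕ, ∀ y, ((f ^ n) y).1 = g ^ n • y.1 := by
      intro n
      induction n with
      | zero =>
        intro y
        rw [pow_zero, pow_zero, one_smul]
        rfl
      | succ n ih =>
        intro y
        rw [pow_succ, pow_succ, mul_smul]
        exact ih (f y)
    have hf : f ^ q ^ 1 = 1 := by
      funext y
      apply Subtype.ext
      rw [hfn, pow_one, ← hg, pow_orderOf_eq_one, one_smul]
      rfl
    have h1 := Equiv.Perm.card_fixedPoints_modEq hf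
    rw [Fintype.card_subtype, hp.card_class] at h1
    convert h1 using 1
    rw [← Fintype.card_subtype]
    refine Fintype.card_congr
      { toFun := fun y => ⟨⟨y.1, y.2.1⟩, Subtype.ext y.2.2⟩
        invFun := fun y => ⟨y.1.1, y.1.2, congrArg Subtype.val y.2⟩
        left_inv := fun y => rfl
        right_inv := fun y => rfl }
  obtain ⟨y, hy⟩ : ∃ y, π y ≠ π x := by
    obtain ⟨a, b, hab⟩ := h.exists_ne
    by_cases ha : π a = π x
    · exact ⟨b, fun e => hab (ha.trans e.symm)⟩
    · exact ⟨a, ha⟩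
  have h1 := key (π x)
  have h0 := key (π y)
  have e1 : #{z | π z = π x ∧ g • z = z} = 1 := by
    rw [card_eq_one]
    refine ⟨x, ?_⟩
    ext z
    simp only [mem_filter, mem_univ, true_and, mem_singleton]
    exact ⟨fun hz => huniq z hz.2, by rintro rfl; exact ⟨rfl, hx⟩⟩
  have e0 : #{z | π z = π y ∧ g • z = z} = 0 := by
    rw [card_eq_zero, filter_eq_empty_iff]
    rintro z - ⟨hz, hgz⟩
    rw [huniq z hgz] at hz
    exact hy hz.symm
  rw [e1] at h1
  rw [e0] at h0
  have := (Nat.modEq_zero_iff_dvd.1 (h1.symm.trans h0))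
  exact hq.one_lt.ne' (Nat.dvd_one.1 this)

/-- The stabiliser of a point in the kernel of the action on classes fixes the whole class. -/
theorem smul_eq_of_smul_eq_of_map_eq [Finite G] [FaithfulSMul G P]
    (h : IsFlagTransitiveImprimitive G π pts k) (hp : HasParameters π pts k c) (hc : Even c)
    {g : G} (hgQ : ∀ q : Q, g • q = q) {x y : P} (hgx : g • x = x) (hxy : π y = π x) :
    g • y = y := by
  let K : Subgroup G := (MulAction.toPermHom G Q).ker ⊓ MulAction.stabilizer G x
  have hK : ∀ a : G, a ∈ K ↔ (∀ q : Q, a • q = q) ∧ a • x = x := by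
    intro a
    simp [K, Subgroup.mem_inf, MonoidHom.mem_ker, Equiv.ext_iff]
  have hK2 : IsPGroup 2 K := by
    rintro ⟨a, ha⟩
    have hpos : 0 < orderOf a := orderOf_pos a
    rcases Nat.eq_two_pow_or_exists_odd_prime_and_dvd (orderOf a) with ⟨n, hn⟩ | ⟨q, hq, hqa, hqo⟩
    · exact ⟨n, Subtype.ext (by simp [← hn, pow_orderOf_eq_one])⟩
    · exfalso
      have ho : orderOf (a ^ (orderOf a / q)) = q := orderOf_pow_orderOf_div hpos.ne' hqa
      have hm : a ^ (orderOf a / q) ∈ K := K.pow_mem ha _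
      rw [hK] at hm
      refine h.smul_ne_of_orderOf_prime hp hq ?_ ho hm.1 x hm.2
      rintro rfl
      exact absurd hqo (by decide)
  by_cases hyx : y = x
  · rw [hyx, hgx]
  let S : SubMulAction K P :=
    { carrier := {z | π z = π x ∧ z ≠ x}
      smul_mem' := by
        rintro ⟨a, ha⟩ z ⟨hz, hzx⟩
        rw [hK] at ha
        refine ⟨?_, fun e => hzx (MulAction.injective a (e.trans ha.2.symm))⟩
        change π (a • z) = _
        rw [h.map_smul, ha.1, hz] }
  have hS : Nat.card S = c - 1 := by
    have : Nat.card S = #(({z | π z = π x} : Finset P).erase x) := by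
      rw [← Nat.card_eq_finsetCard]
      refine Nat.card_congr (Equiv.subtypeEquivRight fun z => ?_)
      rw [mem_erase, mem_filter_univ, and_comm]
      rfl
    rw [this, card_erase_of_mem (by simp), hp.card_class]
  have hcpos : 0 < c := by
    rw [← hp.card_class (π x)]
    exact card_pos.2 ⟨x, by simp⟩
  obtain ⟨⟨z, hz, hzx⟩, hzfix⟩ : (MulAction.fixedPoints K S).Nonempty := by
    have := Fact.mk Nat.prime_two
    refine IsPGroup.nonempty_fixed_point_of_prime_not_dvd_card hK2 S ?_
    rw [hS]
    obtain ⟨n, hn⟩ := hc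
    omega
  obtain ⟨b, hbx, hbz⟩ := h.exists_smul_eq_of_map_eq hp hz hxy (Ne.symm hzx) (Ne.symm hyx)
  have hconj : b⁻¹ * g * b ∈ K := by
    rw [hK]
    refine ⟨fun q => ?_, ?_⟩
    · rw [mul_smul, mul_smul, hgQ, inv_smul_smul]
    · rw [mul_smul, mul_smul, hbx, hgx, inv_smul_eq_iff, hbx]
  have h1 := congrArg Subtype.val (hzfix ⟨_, hconj⟩)
  change (b⁻¹ * g * b) • z = z at h1
  rw [mul_smul, mul_smul, hbz, inv_smul_eq_iff, hbz] at h1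
  exact h1

/-- If the number of classes is twice an odd prime, then the group acts faithfully on them. -/
theorem eq_one_of_forall_smul_eq [Finite G] [FaithfulSMul G P]
    (h : IsFlagTransitiveImprimitive G π pts k) {p : ℕ} (hpp : p.Prime) (hp2 : p ≠ 2)
    (hp : HasParameters π pts k (2 * p)) {g : G} (hgQ : ∀ q : Q, g • q = q) : g = 1 := by
  by_contra hg1
  obtain ⟨x, hgx⟩ : ∃ x : P, g • x ≠ x := by
    by_contra! hcon
    exact hg1 (FaithfulSMul.eq_of_smul_eq_smul fun z : P => by rw [hcon, one_smul])
  let K : Subgroup G := (MulAction.toPermHom G Q).ker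
  have hKn : K.Normal := MonoidHom.normal_ker _
  have hK : ∀ a : G, a ∈ K ↔ ∀ q : Q, a • q = q := by
    intro a
    simp [K, MonoidHom.mem_ker, Equiv.ext_iff]
  have hKmap : ∀ a ∈ K, ∀ z : P, π (a • z) = π z := fun a ha z => by
    rw [h.map_smul, (hK a).1 ha]
  have hfix : ∀ a ∈ K, a • x = x → ∀ z, π z = π x → a • z = z := fun a ha hax z hz =>
    h.smul_eq_of_smul_eq_of_map_eq hp ⟨p, by ring⟩ ((hK a).1 ha) hax hz
  have horbit : (MulAction.orbit K x) = {z | π z = π x} := by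
    ext z
    refine ⟨?_, fun hz => ?_⟩
    · rintro ⟨⟨a, ha⟩, rfl⟩
      exact hKmap a ha x
    · by_cases hzx : x = z
      · exact ⟨1, by simpa using hzx⟩
      obtain ⟨b, hbx, hbz⟩ := h.exists_smul_eq_of_map_eq hp (hKmap g ((hK g).2 hgQ) x) hz
        (Ne.symm hgx) hzx
      refine ⟨⟨b * g * b⁻¹, hKn.conj_mem g ((hK g).2 hgQ) b⟩, ?_⟩
      change (b * g * b⁻¹) • x = z
      rw [mul_smul, mul_smul, inv_smul_eq_iff.2 hbx.symm, hbz]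
  let N : Subgroup K := MulAction.stabilizer K x
  have hN : ∀ a : K, a ∈ N ↔ a.1 • x = x := fun a => Iff.rfl
  have hNn : N.Normal := by
    refine ⟨fun n hn a => ?_⟩
    rw [hN] at hn ⊢
    simp only [Subgroup.coe_mul, InvMemClass.coe_inv, mul_smul]
    rw [hfix n.1 n.2 hn, smul_inv_smul]
    exact hKmap _ (K.inv_mem a.2) x
  have hcard : Nat.card (K ⧸ N) = 2 * p := by
    rw [← Subgroup.index_eq_card, MulAction.index_stabilizer, horbit, ← hp.card_class (π x),
      ← Set.ncard_coe_finset]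
    congr 1
    ext
    simp
  have hex : ∀ q : ℕ, q.Prime → q ∣ 2 * p → ∃ a : K, a.1 • x ≠ x ∧ a ^ q ∈ N := by
    intro q hq hdvd
    have := Fact.mk hq
    obtain ⟨a, ha⟩ := exists_prime_orderOf_dvd_card' q (hcard ▸ hdvd)
    obtain ⟨a, rfl⟩ := QuotientGroup.mk_surjective a
    refine ⟨a, fun e => ?_, ?_⟩
    · rw [(QuotientGroup.eq_one_iff a).2 e, orderOf_one] at ha
      exact hq.one_lt.ne ha
    · rw [← QuotientGroup.eq_one_iff, QuotientGroup.mk_pow, ← ha, pow_orderOf_eq_one]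
  obtain ⟨a, hax, ha⟩ := hex 2 Nat.prime_two (dvd_mul_right _ _)
  obtain ⟨a', hax', ha'⟩ := hex p hpp (dvd_mul_left _ _)
  obtain ⟨b, hbx, hb⟩ := h.exists_smul_eq_of_map_eq hp (hKmap a.1 a.2 x) (hKmap a'.1 a'.2 x)
    (Ne.symm hax) (Ne.symm hax')
  have hbx' : b⁻¹ • x = x := inv_smul_eq_iff.2 hbx.symm
  let d : K := ⟨b * a.1 * b⁻¹, hKn.conj_mem a.1 a.2 b⟩
  have hd : d.1 • x = a'.1 • x := by
    change (b * a.1 * b⁻¹) • x = _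
    rw [mul_smul, mul_smul, hbx', hb]
  have hd2 : d ^ 2 ∈ N := by
    rw [hN] at ha ⊢
    have : (d ^ 2).1 = b * (a ^ 2).1 * b⁻¹ := by
      simp only [d, SubmonoidClass.mk_pow, SubmonoidClass.coe_pow, conj_pow]
    rw [this, mul_smul, mul_smul, hbx', ha, hbx]
  have hda : (QuotientGroup.mk d : K ⧸ N) = QuotientGroup.mk a' := by
    rw [QuotientGroup.eq, hN, Subgroup.coe_mul, InvMemClass.coe_inv, mul_smul, ← hd,
      inv_smul_smul]
  have h2 : (QuotientGroup.mk a' : K ⧸ N) ^ 2 = 1 := by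
    rw [← hda, ← QuotientGroup.mk_pow, QuotientGroup.eq_one_iff]
    exact hd2
  have h3 : (QuotientGroup.mk a' : K ⧸ N) ^ p = 1 := by
    rw [← QuotientGroup.mk_pow, QuotientGroup.eq_one_iff]
    exact ha'
  have h4 : (QuotientGroup.mk a' : K ⧸ N) ^ Nat.gcd 2 p = 1 := pow_gcd_eq_one.2 ⟨h2, h3⟩
  rw [(Nat.coprime_primes Nat.prime_two hpp).2 (Ne.symm hp2), pow_one,
    QuotientGroup.eq_one_iff] at h4
  exact hax' h4

end IsFlagTransitiveImprimitive

section Jordan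

variable {α : Type*} [Fintype α] {p : ℕ}

/-- A group of permutations of `2 * p` letters with order divisible by `p ^ 2` contains a
`p`-cycle, because it contains a Sylow subgroup of the symmetric group. -/
theorem exists_isCycle_mem_of_sq_dvd_card (hpp : p.Prime) (hp2 : p ≠ 2)
    (hα : Fintype.card α = 2 * p) (H : Subgroup (Equiv.Perm α)) (hdvd : p ^ 2 ∣ Nat.card H) :
    ∃ g ∈ H, g.IsCycle ∧ #g.support = p := by
  have := Fact.mk hpp
  obtain ⟨σ, hσ⟩ : ∃ g : Equiv.Perm α, g.cycleType = {p} :=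
    (Equiv.Perm.exists_with_cycleType_iff α).2 ⟨by simp [hα]; omega, by simpa using hpp.two_le⟩
  have hσc : σ.IsCycle := Equiv.Perm.card_cycleType_eq_one.1 (by simp [hσ])
  have hσp : #σ.support = p := by rw [← Equiv.Perm.sum_cycleType, hσ, Multiset.sum_singleton]
  obtain ⟨R, hR⟩ := Sylow.exists_subgroup_card_pow_prime p hdvd
  have hfac : (Nat.card (Equiv.Perm α)).factorization p = 2 := by
    rw [Nat.card_perm, Nat.card_eq_fintype_card, hα, mul_comm,
      Nat.factorization_factorial_mul hpp, Nat.factorial_two,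
      Nat.factorization_eq_zero_of_not_dvd]
    intro h
    exact hp2 ((Nat.prime_dvd_prime_iff_eq hpp Nat.prime_two).1 h)
  let S : Sylow p (Equiv.Perm α) := Sylow.ofCard (R.map H.subtype) (by
    rw [Subgroup.card_map_of_injective H.subtype_injective, hR, hfac])
  have hpg : IsPGroup p (Subgroup.zpowers σ) :=
    IsPGroup.of_card (n := 1) (by rw [Nat.card_zpowers, hσc.orderOf, hσp, pow_one])
  obtain ⟨S', hS'⟩ := hpg.exists_le_sylow
  obtain ⟨τ, hτ⟩ := MulAction.exists_smul_eq (Equiv.Perm α) S' S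
  refine ⟨τ * σ * τ⁻¹, ?_, hσc.conj, by rw [Equiv.Perm.card_support_conj, hσp]⟩
  have h1 : τ * σ * τ⁻¹ ∈ S := by
    rw [← hτ, Sylow.smul_def]
    exact Subgroup.smul_mem_pointwise_smul σ (MulAut.conj τ) _ (hS' (Subgroup.mem_zpowers σ))
  obtain ⟨a, -, ha⟩ := Subgroup.mem_map.1 (show τ * σ * τ⁻¹ ∈ R.map H.subtype from h1)
  rw [← ha]
  exact a.2

theorem isMultiplyPretransitive_of_sq_dvd_card (hpp : p.Prime) (hp2 : p ≠ 2)
    (hα : Fintype.card α = 2 * p) (H : Subgroup (Equiv.Perm α)) (hdvd : p ^ 2 ∣ Nat.card H)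
    (h2 : MulAction.IsMultiplyPretransitive H α 2) :
    MulAction.IsMultiplyPretransitive H α (p + 1) := by
  obtain ⟨g, hg, hgc, hgp⟩ := exists_isCycle_mem_of_sq_dvd_card hpp hp2 hα H hdvd
  have hp3 : 3 ≤ p := by have := hpp.two_le; omega
  obtain ⟨n, rfl⟩ : ∃ n, p = n + 1 := ⟨p - 1, by omega⟩
  have := Equiv.Perm.isPretransitive_of_isCycle_mem hgc hg
  suffices MulAction.IsMultiplyPreprimitive H α (n + 2) from
    MulAction.IsMultiplyPreprimitive.isMultiplyPretransitive ..
  refine (MulAction.isPreprimitive_of_is_two_pretransitive h2).isMultiplyPreprimitive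
    (s := (g.supportᶜ : Set α)) ?_ ?_ (MulAction.IsPreprimitive.of_prime_card ?_)
  · apply Nat.add_left_cancel
    rw [Set.ncard_add_ncard_compl, Set.ncard_coe_finset, hgp, Nat.card_eq_fintype_card, hα]
    omega
  · rw [Nat.card_eq_fintype_card, hα]
    omega
  · convert! hpp
    rw [Nat.card_eq_fintype_card, Fintype.card_subtype, ← hgp]
    congr 1
    ext x
    simp [SubMulAction.mem_ofFixingSubgroup_iff]

end Jordan

namespace IsFlagTransitiveImprimitive

variable {π : P → Q} {pts : T → Finset P} {k c p : ℕ}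

theorem exists_smul_class_eq (h : IsFlagTransitiveImprimitive G π pts k)
    (hp : HasParameters π pts k c) (hc : 2 ≤ c) {q₁ q₂ q₁' q₂' : Q} (hq : q₁ ≠ q₂)
    (hq' : q₁' ≠ q₂') : ∃ g : G, g • q₁ = q₁' ∧ g • q₂ = q₂' := by
  obtain ⟨x, rfl⟩ := h.surj q₁
  obtain ⟨x', rfl⟩ := h.surj q₁'
  obtain ⟨g, hg⟩ := h.exists_smul_eq x x'
  have hg' : g • π x = π x' := by rw [← h.map_smul, hg]
  obtain ⟨g', hgx, hgq⟩ := h.exists_smul_map_eq hp hc (x := x') (q := g • q₂) (q' := q₂')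
    (fun e => hq (MulAction.injective g (hg'.trans e.symm))) (Ne.symm hq')
  refine ⟨g' * g, ?_, by rw [mul_smul, hgq]⟩
  rw [mul_smul, hg', ← h.map_smul, hgx]

theorem sq_dvd_card [Finite G] (h : IsFlagTransitiveImprimitive G π pts k)
    (hp : HasParameters π pts k (2 * p)) : p ^ 2 ∣ Nat.card G := by
  obtain ⟨x, -⟩ := h.exists_ne
  have horb : MulAction.orbit G x = Set.univ :=
    Set.eq_univ_of_forall fun y => h.exists_smul_eq x y
  have hcard : Fintype.card P = 2 * p * (2 * p) := by
    rw [← card_univ, card_eq_sum_card_fiberwise (f := π) (t := univ) (by simp),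
      sum_congr rfl fun q _ => hp.card_class q, sum_const, smul_eq_mul, card_univ,
      hp.card_classes]
  have := Subgroup.index_dvd_card (MulAction.stabilizer G x)
  rw [MulAction.index_stabilizer, horb, Set.ncard_univ, Nat.card_eq_fintype_card, hcard] at this
  exact (Dvd.intro_left 4 (by ring)).trans this

/-- If the number of classes is twice an odd prime `p`, then the group is transitive on the sets
of `p + 1` classes. -/
theorem exists_image_smul_eq [Finite G] [FaithfulSMul G P]
    (h : IsFlagTransitiveImprimitive G π pts k) (hpp : p.Prime) (hp2 : p ≠ 2)
    (hp : HasParameters π pts k (2 * p)) {S S' : Finset Q} (hS : #S = p + 1) (hS' : #S' = p + 1) :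
    ∃ g : G, S.image (g • ·) = S' := by
  let φ := MulAction.toPermHom G Q
  have hφ : Function.Injective φ := (injective_iff_map_eq_one φ).2 fun g hg =>
    h.eq_one_of_forall_smul_eq hpp hp2 hp fun q => Equiv.congr_fun hg q
  have hdvd : p ^ 2 ∣ Nat.card φ.range := by
    rw [← Nat.card_congr (MonoidHom.ofInjective hφ).toEquiv]
    exact h.sq_dvd_card hp
  have h2 : MulAction.IsMultiplyPretransitive φ.range Q 2 := by
    rw [MulAction.is_two_pretransitive_iff]
    intro a b a' b' hab hab'
    obtain ⟨g, hg, hg'⟩ := h.exists_smul_class_eq hp (by have := hpp.two_le; omega) hab hab'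
    exact ⟨⟨φ g, g, rfl⟩, hg, hg'⟩
  have hm := isMultiplyPretransitive_of_sq_dvd_card hpp hp2 hp.card_classes φ.range hdvd h2
  obtain ⟨⟨_, g, rfl⟩, hg⟩ := MulAction.isMultiplyPretransitive_iff.1 hm
    ((S.equivFinOfCardEq hS).symm.toEmbedding.trans (.subtype _))
    ((S'.equivFinOfCardEq hS').symm.toEmbedding.trans (.subtype _))
  refine ⟨g, eq_of_subset_of_card_le ?_ ?_⟩
  · intro _ hq'
    obtain ⟨q, hq, rfl⟩ := mem_image.1 hq'
    have := DFunLike.congr_fun hg (S.equivFinOfCardEq hS ⟨q, hq⟩)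
    have e : g • q = ((S'.equivFinOfCardEq hS').symm (S.equivFinOfCardEq hS ⟨q, hq⟩)).1 := by
      refine Eq.trans ?_ this
      change _ = g • ((S.equivFinOfCardEq hS).symm (S.equivFinOfCardEq hS ⟨q, hq⟩)).1
      rw [Equiv.symm_apply_apply]
    change g • q ∈ S'
    rw [e]
    exact Subtype.prop _
  · rw [card_image_of_injective _ (MulAction.injective g), hS, hS']

theorem image_smul_pts (h : IsFlagTransitiveImprimitive G π pts k) (g : G) (t : T) :
    (pts (g • t)).image π = ((pts t).image π).image (g • ·) := by
  rw [h.smul_pts, map_eq_image, image_image, image_image]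
  exact image_congr fun x _ => h.map_smul g x

/-- If the number of classes is twice an odd prime `p`, then every set of `p + 1` classes is the
set of classes met by a block, for a constant number of blocks. -/
theorem exists_card_fiber [Finite G] [FaithfulSMul G P]
    (h : IsFlagTransitiveImprimitive G π pts k) (hpp : p.Prime) (hp2 : p ≠ 2)
    (hp : HasParameters π pts k (2 * p)) :
    ∃ m, Fintype.card T = (2 * p).choose (p + 1) * m ∧
      ∀ S : Finset Q, #S = p + 1 → #{t | (pts t).image π = S} = m := by
  have hcard : ∀ t, #((pts t).image π) = p + 1 := fun t => by
    have h1 := card_block_eq hp.card_inter t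
    have h2 := hp.block_size
    rw [h.card_pts] at h1
    omega
  obtain ⟨x, y, hxy⟩ := h.exists_ne
  obtain ⟨t₀, -⟩ := h.exists_block fun e => hxy (congrArg π e)
  have hconst : ∀ S : Finset Q, #S = p + 1 →
      #{t | (pts t).image π = S} = #{t | (pts t).image π = (pts t₀).image π} := by
    intro S hS
    obtain ⟨g, hg⟩ := h.exists_image_smul_eq hpp hp2 hp (hcard t₀) hS
    refine (card_bij (fun t _ => g • t) ?_ ?_ ?_).symm
    · intro t ht
      rw [mem_filter_univ] at ht ⊢
      rw [h.image_smul_pts, ht, hg]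
    · intro t _ t' _ e
      exact MulAction.injective g e
    · intro t ht
      rw [mem_filter_univ] at ht
      refine ⟨g⁻¹ • t, ?_, smul_inv_smul g t⟩
      rw [mem_filter_univ, h.image_smul_pts, ht, ← hg, image_image]
      simp [Function.comp_def]
  refine ⟨_, ?_, hconst⟩
  rw [← card_univ, card_eq_sum_card_fiberwise (f := fun t => (pts t).image π)
    (t := powersetCard (p + 1) univ) (fun t _ => by simp [hcard t]),
    sum_congr rfl fun S hS => hconst S (mem_powersetCard.1 hS).2, sum_const, card_powersetCard,
    card_univ, hp.card_classes, smul_eq_mul]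

/-- In a design with parameters `2`-`(36, 8, 2)`, two distinct blocks meet in one or two points. -/
theorem card_inter_of_six (h : IsFlagTransitiveImprimitive G π pts k)
    (hp : HasParameters π pts k 6) {t t' : T} (htt : t ≠ t') :
    #(pts t ∩ pts t') = 1 ∨ #(pts t ∩ pts t') = 2 := by
  have hk := hp.block_size
  have hT := hp.card_blocks
  have e1 : ∑ s, #(pts t ∩ pts s) = 80 := by
    have := sum_card_bipartiteAbove_eq_sum_card_bipartiteBelow
      (fun (s : T) (x : P) => x ∈ pts s) (s := univ) (t := pts t)
    simp only [bipartiteAbove, bipartiteBelow, hp.degree, sum_const, h.card_pts, hk] at this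
    simp only [filter_mem_eq_inter] at this
    rw [this]
    rfl
  have e2 : ∑ s, #(pts t ∩ pts s) ^ 2 = 192 := by
    have h1 := sum_sum_pts pts (fun x y => if x ∈ pts t ∧ y ∈ pts t then (1 : ℕ) else 0)
    have h2 : ∀ s, ∑ x ∈ pts s, ∑ y ∈ pts s, (if x ∈ pts t ∧ y ∈ pts t then (1 : ℕ) else 0)
        = #(pts t ∩ pts s) ^ 2 := fun s => by
      simp only [ite_and, sum_ite_irrel, sum_const_zero, sum_ite_mem, sum_const, smul_eq_mul,
        mul_one]
      rw [inter_comm, pow_two]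
    rw [← sum_congr rfl fun s _ => h2 s, h1]
    have h3 : ∀ x, ∑ y, (if x ∈ pts t ∧ y ∈ pts t then (1 : ℕ) else 0) *
        (#{s | x ∈ pts s ∧ y ∈ pts s} : ℕ) = if x ∈ pts t then 24 else 0 := fun x => by
      split_ifs with hx
      · simp only [hx, true_and, ite_mul, one_mul, zero_mul, sum_ite_mem, univ_inter]
        rw [← add_sum_erase _ _ hx, sum_congr rfl (g := fun _ => 2), sum_const,
          card_erase_of_mem hx, h.card_pts, hk]
        · simp only [and_self, hp.degree]
          norm_num
        · intro y hy
          simpa using h.card_two x y (Ne.symm (ne_of_mem_erase hy))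
      · simp [hx]
    simp only [Nat.cast_id] at h3 ⊢
    rw [sum_congr rfl fun x _ => h3 x, sum_ite_mem, univ_inter, sum_const, h.card_pts, hk]
    rfl
  have e3 : ∑ s, ((#(pts t ∩ pts s) : ℤ) - 1) * (#(pts t ∩ pts s) - 2) = 42 := by
    have e1' : ∑ s, (#(pts t ∩ pts s) : ℤ) = 80 := by exact_mod_cast e1
    have e2' : ∑ s, (#(pts t ∩ pts s) : ℤ) ^ 2 = 192 := by exact_mod_cast e2
    have hT' : Fintype.card T = 45 := by omega
    calc _ = ∑ s, ((#(pts t ∩ pts s) : ℤ) ^ 2 - 3 * #(pts t ∩ pts s) + 2) :=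
          sum_congr rfl fun s _ => by ring
      _ = 42 := by
          rw [sum_add_distrib, sum_sub_distrib, ← mul_sum, e1', e2', sum_const, card_univ, hT']
          norm_num
  rw [← add_sum_erase _ _ (mem_univ t), inter_self, h.card_pts, hk] at e3
  have hnn : ∀ n : ℕ, 0 ≤ ((n : ℤ) - 1) * (n - 2) := fun n => by
    rcases n with _ | _ | n
    · norm_num
    · norm_num
    · push_cast
      nlinarith
  have e4 : ∑ s ∈ univ.erase t, ((#(pts t ∩ pts s) : ℤ) - 1) * (#(pts t ∩ pts s) - 2) = 0 := by
    push_cast at e3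
    linarith
  have := (sum_eq_zero_iff_of_nonneg fun s _ => hnn _).1 e4 t'
    (mem_erase.2 ⟨Ne.symm htt, mem_univ _⟩)
  rcases mul_eq_zero.1 this with h' | h' <;> omega

theorem card_filter_inter_smul (h : IsFlagTransitiveImprimitive G π pts k) (g : G) (t t' : T)
    (q : Q) : #{x ∈ pts (g • t) ∩ pts (g • t') | π x = g • q} = #{x ∈ pts t ∩ pts t' | π x = q} := by
  rw [h.smul_pts, h.smul_pts, ← map_inter, filter_map, card_map]
  congr 1
  refine filter_congr fun x _ => ?_
  change π (g • x) = g • q ↔ _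
  rw [h.map_smul]
  exact (MulAction.injective g).eq_iff

/-- The number of points in a given class that a block shares with the other blocks meeting the
same classes is constant. -/
theorem sum_card_filter_inter_eq (h : IsFlagTransitiveImprimitive G π pts k) (t : T) {q q' : Q}
    (hq : q ∈ (pts t).image π) (hq' : q' ∈ (pts t).image π) :
    ∑ t' with t' ≠ t ∧ (pts t').image π = (pts t).image π, #{x ∈ pts t ∩ pts t' | π x = q}
      = ∑ t' with t' ≠ t ∧ (pts t').image π = (pts t).image π,
        #{x ∈ pts t ∩ pts t' | π x = q'} := by
  obtain ⟨x, hx, rfl⟩ := mem_image.1 hq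
  obtain ⟨x', hx', rfl⟩ := mem_image.1 hq'
  obtain ⟨g, hgt, hgx⟩ := h.flag t t x x' hx hx'
  have him := h.image_smul_pts g t
  rw [hgt] at him
  refine sum_bij (fun t' _ => g • t') ?_ ?_ ?_ ?_
  · intro t' ht'
    rw [mem_filter_univ] at ht' ⊢
    refine ⟨fun e => ht'.1 (MulAction.injective g (e.trans hgt.symm)), ?_⟩
    rw [h.image_smul_pts, ht'.2, ← him]
  · intro t₁ _ t₂ _ e
    exact MulAction.injective g e
  · intro t' ht'
    rw [mem_filter_univ] at ht'
    refine ⟨g⁻¹ • t', ?_, smul_inv_smul g t'⟩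
    rw [mem_filter_univ]
    refine ⟨fun e => ht'.1 ?_, ?_⟩
    · rw [inv_smul_eq_iff.1 e, hgt]
    · rw [h.image_smul_pts, ht'.2]
      nth_rw 1 [him]
      simp [image_image, Function.comp_def]
  · intro t' _
    rw [← h.card_filter_inter_smul g t t', hgt, ← h.map_smul, hgx]

theorem not_hasParameters_six [Finite G] [FaithfulSMul G P]
    (h : IsFlagTransitiveImprimitive G π pts k) : ¬ HasParameters π pts k 6 := by
  intro hp
  obtain ⟨m, hm, hfib⟩ := h.exists_card_fiber Nat.prime_three (by norm_num) (p := 3) hp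
  have hT := hp.card_blocks
  have hm3 : m = 3 := by
    rw [hm, show Nat.choose (2 * 3) (3 + 1) = 15 by decide] at hT
    omega
  have hcard : ∀ t, #((pts t).image π) = 4 := fun t => by
    have h1 := card_block_eq hp.card_inter t
    have h2 := hp.block_size
    rw [h.card_pts] at h1
    omega
  have hfib' : ∀ t, #{t' | t' ≠ t ∧ (pts t').image π = (pts t).image π} = 2 := fun t => by
    have h1 := hfib _ (hcard t)
    have h2 : ({t' | t' ≠ t ∧ (pts t').image π = (pts t).image π} : Finset T)
        = ({t' | (pts t').image π = (pts t).image π} : Finset T).erase t := by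
      ext t'
      simp
    rw [h2, card_erase_of_mem (by simp), h1, hm3]
  have hone : ∀ t, ∀ q ∈ (pts t).image π,
      ∑ t' with t' ≠ t ∧ (pts t').image π = (pts t).image π,
        #{x ∈ pts t ∩ pts t' | π x = q} = 1 := by
    intro t q hq
    have h1 : ∑ q' ∈ (pts t).image π, ∑ t' with t' ≠ t ∧ (pts t').image π = (pts t).image π,
        #{x ∈ pts t ∩ pts t' | π x = q'}
        = ∑ t' with t' ≠ t ∧ (pts t').image π = (pts t).image π, #(pts t ∩ pts t') := by
      rw [sum_comm]
      refine sum_congr rfl fun t' _ => ?_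
      exact (card_eq_sum_card_fiberwise fun x hx =>
        mem_image_of_mem π (mem_of_mem_inter_left hx)).symm
    rw [sum_congr rfl fun q' hq' => h.sum_card_filter_inter_eq t hq' hq, sum_const, hcard,
      smul_eq_mul] at h1
    have h2 : ∀ t' ∈ ({t' | t' ≠ t ∧ (pts t').image π = (pts t).image π} : Finset T),
        1 ≤ #(pts t ∩ pts t') ∧ #(pts t ∩ pts t') ≤ 2 := fun t' ht' => by
      rw [mem_filter_univ] at ht'
      rcases h.card_inter_of_six hp (Ne.symm ht'.1) with e | e <;> omega
    have h3 := card_nsmul_le_sum _ _ _ fun t' ht' => (h2 t' ht').1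
    have h4 := sum_le_card_nsmul _ _ _ fun t' ht' => (h2 t' ht').2
    rw [hfib'] at h3 h4
    simp only [smul_eq_mul] at h3 h4
    omega
  obtain ⟨a, b, hab⟩ := h.exists_ne
  obtain ⟨t₀, ha, -⟩ := h.exists_block fun e => hab (congrArg π e)
  have hF := hfib _ (hcard t₀)
  rw [hm3, card_eq_three] at hF
  obtain ⟨t₁, t₂, t₃, h12, h13, h23, hF⟩ := hF
  have hmem : ∀ t, (pts t).image π = (pts t₀).image π ↔ t = t₁ ∨ t = t₂ ∨ t = t₃ := fun t => by
    rw [← mem_filter_univ (p := fun t => (pts t).image π = (pts t₀).image π), hF]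
    simp
  have hpair : ∀ r s u, (∀ t, (pts t).image π = (pts t₀).image π ↔ t = r ∨ t = s ∨ t = u) →
      r ≠ s → r ≠ u → s ≠ u →
      #{x ∈ pts r ∩ pts s | π x = π a} + #{x ∈ pts r ∩ pts u | π x = π a} = 1 := by
    intro r s u hrsu hrs hru hsu
    have hr := (hrsu r).2 (Or.inl rfl)
    have h1 := hone r (π a) (hr ▸ mem_image_of_mem π ha)
    have h2 : ({t' | t' ≠ r ∧ (pts t').image π = (pts r).image π} : Finset T) = {s, u} := by
      ext t'
      rw [mem_filter_univ, hr, hrsu, mem_insert, mem_singleton]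
      grind
    rwa [h2, sum_pair hsu] at h1
  have e1 := hpair t₁ t₂ t₃ hmem h12 h13 h23
  have e2 := hpair t₂ t₁ t₃ (fun t => (hmem t).trans (by tauto)) h12.symm h23 h13
  have e3 := hpair t₃ t₁ t₂ (fun t => (hmem t).trans (by tauto)) h13.symm h23.symm h12
  rw [inter_comm] at e2
  rw [inter_comm, inter_comm (pts t₃) (pts t₂)] at e3
  omega

theorem card_eq_sixteen [Finite G] [FaithfulSMul G P]
    (h : IsFlagTransitiveImprimitive G π pts k) :
    Fintype.card P = 16 ∧ k = 6 ∧ Fintype.card T = 16 := by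
  obtain ⟨c, hp, rfl | rfl | rfl | rfl⟩ := h.hasParameters
  · have hT := hp.card_blocks
    refine ⟨?_, hp.block_size, by omega⟩
    rw [← card_univ, card_eq_sum_card_fiberwise (f := π) (t := univ) (by simp),
      sum_congr rfl fun q _ => hp.card_class q, sum_const, smul_eq_mul, card_univ,
      hp.card_classes]
  · exact absurd hp h.not_hasParameters_six
  · obtain ⟨m, hm, -⟩ := h.exists_card_fiber Nat.prime_five (by norm_num) (p := 5) hp
    have hT := hp.card_blocks
    rw [hm, show Nat.choose (2 * 5) (5 + 1) = 210 by decide] at hT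
    omega
  · obtain ⟨m, hm, -⟩ := h.exists_card_fiber Nat.prime_eleven (by norm_num) (p := 11) hp
    have hT := hp.card_blocks
    rw [hm, show Nat.choose (2 * 11) (11 + 1) = 646646 by simp +decide] at hT
    omega

end IsFlagTransitiveImprimitive

end Designs

/-- If a nontrivial `2`-`(v, k, 2)` design admits a flag-transitive, point-imprimitive
group of automorphisms, then `v = 16`, `k = 6` and the design is symmetric
(it has exactly `16` blocks). -/
theorem flag_transitive_imprimitive_sixteen (v k : ℕ) (P : Type*) (Bs : Set (Set P))
    (hD : IsTwoDesign v k 2 P Bs) (hk : 2 < k) (hkv : k < v)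
    (G : Subgroup (Equiv.Perm P)) (hGaut : IsAutomGroup G Bs)
    (hft : IsFlagTransitive G Bs)
    (himpr : ∃ C : Set (Set P), IsInvariantPartition G C ∧
      (∃ Δ₁ ∈ C, ∃ Δ₂ ∈ C, Δ₁ ≠ Δ₂) ∧ (∃ Δ ∈ C, ∃ a ∈ Δ, ∃ b ∈ Δ, a ≠ b)) :
    v = 16 ∧ k = 6 ∧ Nat.card Bs = 16 := by
  obtain ⟨hv, hBk, hB2⟩ := hD
  obtain ⟨C, ⟨⟨hCne, hCex⟩, hCinv⟩, ⟨Δ₁, hΔ₁, Δ₂, hΔ₂, hΔ⟩, Δ, hΔC, a, haΔ, b, hbΔ, hab⟩ := himpr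
  classical
  have : Finite P := Nat.finite_of_card_ne_zero (by omega)
  have := Fintype.ofFinite P
  let _ : MulAction G (Set P) := Set.mulActionSet
  let Q : SubMulAction G (Set P) := ⟨C, fun g {s} hs => hCinv g.1 g.2 s hs⟩
  let T : SubMulAction G (Set P) := ⟨Bs, fun g {s} hs => hGaut g.1 g.2 s hs⟩
  choose cl hcl hclu using hCex
  have hcl_eq : ∀ x, ∀ s ∈ C, x ∈ s → s = cl x := fun x s hs hx => hclu x s ⟨hs, hx⟩
  let π : P → Q := fun x => ⟨cl x, (hcl x).1⟩
  let pts : T → Finset P := fun t => t.1.toFinset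
  have hπ : ∀ x y : P, π x = π y ↔ cl x = cl y := fun x y => Subtype.ext_iff
  have hmem : ∀ (x : P) (t : T), x ∈ pts t ↔ x ∈ t.1 := fun x t => Set.mem_toFinset
  have h : IsFlagTransitiveImprimitive G π pts k :=
    { map_smul := fun g x => Subtype.ext <| Eq.symm <|
        hcl_eq _ _ (hCinv g.1 g.2 _ (hcl x).1) (Set.mem_image_of_mem _ (hcl x).2)
      smul_mem := fun g x t hx => (hmem _ _).2 (Set.mem_image_of_mem _ ((hmem _ _).1 hx))
      flag := fun t t' x x' hx hx' => by
        obtain ⟨g, hg, hgt, hgx⟩ := hft t.1 t.2 t'.1 t'.2 x ((hmem _ _).1 hx) x' ((hmem _ _).1 hx')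
        exact ⟨⟨g, hg⟩, Subtype.ext hgt, hgx⟩
      card_pts := fun t => by
        rw [← hBk t.1 t.2, Nat.card_eq_card_toFinset]
      card_two := fun x y hxy => by
        rw [← hB2 x y hxy, ← Fintype.card_subtype, ← Nat.card_eq_fintype_card]
        exact Nat.card_congr
          { toFun := fun t => ⟨t.1.1, t.1.2, (hmem _ _).1 t.2.1, (hmem _ _).1 t.2.2⟩
            invFun := fun t => ⟨⟨t.1, t.2.1⟩, (hmem _ _).2 t.2.2.1, (hmem _ _).2 t.2.2.2⟩
            left_inv := fun _ => rfl
            right_inv := fun _ => rfl }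
      surj := fun q => by
        obtain ⟨x, hx⟩ := hCne q.1 q.2
        exact ⟨x, Subtype.ext (hcl_eq x _ q.2 hx).symm⟩
      two_lt := hk
      lt_card := by rwa [← Nat.card_eq_fintype_card, hv]
      exists_ne := by
        obtain ⟨x, hx⟩ := hCne _ hΔ₁
        obtain ⟨y, hy⟩ := hCne _ hΔ₂
        refine ⟨x, y, fun e => hΔ ?_⟩
        rw [hcl_eq x _ hΔ₁ hx, hcl_eq y _ hΔ₂ hy, (hπ x y).1 e]
      exists_eq := ⟨a, b, hab, (hπ a b).2 ((hcl_eq a _ hΔC haΔ).symm.trans (hcl_eq b _ hΔC hbΔ))⟩ }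
  obtain ⟨h1, h2, h3⟩ := h.card_eq_sixteen
  refine ⟨by rw [← hv, Nat.card_eq_fintype_card, h1], h2, ?_⟩
  rw [← h3, ← Nat.card_eq_fintype_card]
  rfl
end

section
/- Let n ≥ 3, let P be the set of points of PG(n−1,3), and let ℬ = { ℓ∖{γ} : ℓ a line of PG(n−1,3), γ ∈ ℓ }. Then (P,ℬ) is a nontrivial non-symmetric 2-(v,3,2) design with v = (3^n − 1)/2, and the natural image of PSL(n,3) in Sym(P) is a flag-transitive, point-primitive group of automorphisms of (P,ℬ). -/
/-- `G` is transitive on the points and preserves no nontrivial partition of the points: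
every `G`-invariant partition has all parts singletons or is the one-part partition. -/
def IsPointPrimitive {P : Type*} (G : Subgroup (Equiv.Perm P)) : Prop :=
  (∀ x y : P, ∃ g ∈ G, g x = y) ∧
  ∀ C : Set (Set P), IsInvariantPartition G C →
    (∀ Δ ∈ C, ∀ x ∈ Δ, ∀ y ∈ Δ, x = y) ∨ C = {Set.univ}

/-- The points of the projective space `PG(n-1, K)`: the 1-dimensional subspaces of `K^n`. -/
abbrev PGPoint (K : Type*) [Field K] (n : ℕ) :=
  {W : Submodule K (Fin n → K) // Module.finrank K W = 1}

/-- The set of points of `PG(n-1, K)` lying in the subspace `W` of `K^n`. -/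
def pgPointsIn (K : Type*) [Field K] (n : ℕ) (W : Submodule K (Fin n → K)) :
    Set (PGPoint K n) :=
  {x | x.1 ≤ W}

/-- The lines of `PG(n-1, K)`: the sets of points contained in a 2-dimensional
subspace of `K^n`. -/
def pgLines (K : Type*) [Field K] (n : ℕ) : Set (Set (PGPoint K n)) :=
  {s | ∃ W : Submodule K (Fin n → K), Module.finrank K W = 2 ∧ s = pgPointsIn K n W}

/-- The permutation of the points of `PG(n-1, K)` induced by a linear automorphism of `K^n`. -/
def pgPermOfLinearEquiv {K : Type*} [Field K] {n : ℕ}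
    (e : (Fin n → K) ≃ₗ[K] (Fin n → K)) : Equiv.Perm (PGPoint K n) :=
  (Submodule.orderIsoMapComap e).toEquiv.subtypeEquiv fun W => by
    simp only [Submodule.orderIsoMapComap_apply, RelIso.coe_fn_toEquiv]
    exact (LinearEquiv.finrank_map_eq e W).symm ▸ Iff.rfl

/-- The action of the group of linear automorphisms of `K^n` on the points of
`PG(n-1, K)`, as a group homomorphism into the symmetric group on the points. -/
def pgHom (K : Type*) [Field K] (n : ℕ) :
    ((Fin n → K) ≃ₗ[K] (Fin n → K)) →* Equiv.Perm (PGPoint K n) :=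
  MonoidHom.mk' (fun e => pgPermOfLinearEquiv e) (by
    intro a b
    refine Equiv.ext fun x => Subtype.ext ?_
    show (x.1.map (↑(a * b) : (Fin n → K) →ₗ[K] (Fin n → K))) =
      ((x.1.map (b : (Fin n → K) →ₗ[K] (Fin n → K))).map (a : (Fin n → K) →ₗ[K] (Fin n → K)))
    rw [← Submodule.map_comp]
    rfl)

/-- The natural action of `SL(n, K)` on the points of `PG(n-1, K)`, as a group
homomorphism into the symmetric group on the points; its range is the natural image
of `PSL(n, K)` in the symmetric group on the points of `PG(n-1, K)`. -/
def pgSL (K : Type*) [Field K] (n : ℕ) :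
    Matrix.SpecialLinearGroup (Fin n) K →* Equiv.Perm (PGPoint K n) :=
  (pgHom K n).comp Matrix.SpecialLinearGroup.toLin'

/-- The blocks obtained from the lines of `PG(n-1, K)` by Construction 1.2:
all sets `ℓ \ {γ}` for `ℓ` a line and `γ` a point of `ℓ`. -/
def pgConsBlocks (K : Type*) [Field K] (n : ℕ) : Set (Set (PGPoint K n)) :=
  {B | ∃ s ∈ pgLines K n, ∃ γ ∈ s, B = s \ {γ}}

instance : Fact (Nat.Prime 3) := ⟨by norm_num⟩

open Projectivization LinearAlgebra.Projectivization in
/-- The special linear group acts `2`-transitively on the points of projective space. -/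
theorem exists_pgSL_map_pair {K : Type*} [Field K] {n : ℕ} {a b c d : PGPoint K n}
    (hab : a ≠ b) (hcd : c ≠ d) :
    ∃ g ∈ (pgSL K n).range, g a = c ∧ g b = d := by
  have key (g : Matrix.SpecialLinearGroup (Fin n) K) (p : ℙ K (Fin n → K)) :
      pgSL K n g (equivSubmodule K _ p) = equivSubmodule K _ (g • p) := by
    induction p using Projectivization.ind with | _ v hv =>
    rw [smul_mk]
    refine Subtype.ext ?_
    change Submodule.map (Matrix.SpecialLinearGroup.toLin' g).toLinearMap (mk K v hv).submodule =
      (mk K (g • v) ((smul_ne_zero_iff_ne g).mpr hv)).submodule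
    rw [submodule_mk, submodule_mk, Submodule.map_span, Set.image_singleton]
    rfl
  let e := equivSubmodule K (Fin n → K)
  obtain ⟨g, hg₁, hg₂⟩ := (MulAction.is_two_pretransitive_iff
    (G := Matrix.SpecialLinearGroup (Fin n) K)).mp inferInstance
    (e.symm.injective.ne hab) (e.symm.injective.ne hcd)
  refine ⟨pgSL K n g, ⟨g, rfl⟩, ?_, ?_⟩
  · have := key g (e.symm a)
    rw [hg₁] at this
    simpa [e] using this
  · have := key g (e.symm b)
    rw [hg₂] at this
    simpa [e] using this

/-- The image of the points of a subspace under an element of the special linear group is the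
set of points of another subspace of the same dimension. -/
theorem pgSL_image_pgPointsIn {K : Type*} [Field K] {n : ℕ} {g : Equiv.Perm (PGPoint K n)}
    (hg : g ∈ (pgSL K n).range) (W : Submodule K (Fin n → K)) :
    ∃ W' : Submodule K (Fin n → K), Module.finrank K W' = Module.finrank K W ∧
      g '' pgPointsIn K n W = pgPointsIn K n W' := by
  obtain ⟨A, rfl⟩ := hg
  let e := Matrix.SpecialLinearGroup.toLin' A
  refine ⟨W.map (e : (Fin n → K) →ₗ[K] (Fin n → K)), LinearEquiv.finrank_map_eq e W, ?_⟩
  ext x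
  rw [Equiv.image_eq_preimage_symm]
  change Submodule.comap (e : (Fin n → K) →ₗ[K] (Fin n → K)) x.1 ≤ W ↔ x.1 ≤ W.map _
  rw [← Submodule.map_le_map_iff_of_injective (f := (e : (Fin n → K) →ₗ[K] (Fin n → K)))
    e.injective, Submodule.map_comap_eq_of_surjective e.surjective]

/-- Two distinct points span a `2`-dimensional subspace. -/
theorem finrank_sup_of_ne {K : Type*} [Field K] {n : ℕ} {x y : PGPoint K n} (hxy : x ≠ y) :
    Module.finrank K ↥(x.1 ⊔ y.1) = 2 := by
  have h := Submodule.finrank_sup_add_finrank_inf_eq x.1 y.1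
  have hinf : Module.finrank K ↥(x.1 ⊓ y.1) = 0 := by
    by_contra h0
    have hx : x.1 ⊓ y.1 = x.1 := Submodule.eq_of_le_of_finrank_le inf_le_left (by
      rw [x.2]; omega)
    have hy : x.1 ⊓ y.1 = y.1 := Submodule.eq_of_le_of_finrank_le inf_le_right (by
      rw [y.2]; omega)
    exact hxy (Subtype.ext (hx.symm.trans hy))
  have := x.2
  have := y.2
  omega

/-- The only line through two distinct points is the one they span. -/
theorem eq_sup_of_ne {K : Type*} [Field K] {n : ℕ} {x y : PGPoint K n} (hxy : x ≠ y)
    {W : Submodule K (Fin n → K)} (hW : Module.finrank K W = 2)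
    (hx : x ∈ pgPointsIn K n W) (hy : y ∈ pgPointsIn K n W) : W = x.1 ⊔ y.1 :=
  (Submodule.eq_of_le_of_finrank_le (sup_le hx hy) (by rw [hW, finrank_sup_of_ne hxy])).symm

/-- A line over a field with `q` elements has `q + 1` points. -/
theorem ncard_pgPointsIn_of_finrank_eq_two {K : Type*} [Field K] [Finite K] {n : ℕ}
    {W : Submodule K (Fin n → K)} (hW : Module.finrank K W = 2) :
    (pgPointsIn K n W).ncard = Nat.card K + 1 := by
  rw [← Projectivization.card_of_finrank_two K W hW,
    Nat.card_congr (Projectivization.equivSubmodule K W), ← Nat.card_coe_set_eq]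
  have hfin (U : Submodule K W) : Module.finrank K (U.map W.subtype) = Module.finrank K U :=
    Submodule.finrank_map_subtype_eq W U
  refine (Nat.card_congr (Equiv.ofBijective
    (fun U : {H : Submodule K W // Module.finrank K H = 1} =>
      (⟨⟨U.1.map W.subtype, (hfin U.1).trans U.2⟩, Submodule.map_subtype_le W U.1⟩ :
        pgPointsIn K n W)) ⟨?_, ?_⟩)).symm
  · intro U U' h
    exact Subtype.ext (Submodule.map_injective_of_injective W.injective_subtype
      (congrArg (fun z => z.1.1) h))
  · rintro ⟨x, hx⟩
    have hmap : (x.1.comap W.subtype).map W.subtype = x.1 := by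
      rw [Submodule.map_comap_subtype, inf_eq_right]
      exact hx
    exact ⟨⟨x.1.comap W.subtype, by rw [← hfin, hmap, x.2]⟩, Subtype.ext (Subtype.ext hmap)⟩

/-- The number of points of projective space over the field with three elements. -/
theorem card_pgPoint_three (n : ℕ) : Nat.card (PGPoint (ZMod 3) n) = (3 ^ n - 1) / 2 := by
  rw [← Nat.card_congr (Projectivization.equivSubmodule (ZMod 3) (Fin n → ZMod 3)),
    Projectivization.card'']
  simp

/-- The point-deleted lines through two distinct points: delete another point of their line. -/
theorem card_pgConsBlocks_through {K : Type*} [Field K] [Finite K] {n : ℕ} {x y : PGPoint K n}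
    (hxy : x ≠ y) :
    Nat.card {B : Set (PGPoint K n) | B ∈ pgConsBlocks K n ∧ x ∈ B ∧ y ∈ B} =
      Nat.card K - 1 := by
  set L := pgPointsIn K n (x.1 ⊔ y.1)
  have hxL : x ∈ L := le_sup_left (a := x.1)
  have hyL : y ∈ L := le_sup_right (a := x.1)
  have hset : {B : Set (PGPoint K n) | B ∈ pgConsBlocks K n ∧ x ∈ B ∧ y ∈ B} =
      (fun γ => L \ {γ}) '' (L \ {x, y}) := by
    ext B
    constructor
    · rintro ⟨⟨s, ⟨W, hW, rfl⟩, γ, hγ, rfl⟩, hx, hy⟩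
      obtain rfl := eq_sup_of_ne hxy hW hx.1 hy.1
      refine ⟨γ, ⟨hγ, ?_⟩, rfl⟩
      rintro (rfl | rfl)
      exacts [hx.2 rfl, hy.2 rfl]
    · rintro ⟨γ, ⟨hγ, hne⟩, rfl⟩
      simp only [Set.mem_insert_iff, Set.mem_singleton_iff, not_or] at hne
      exact ⟨⟨L, ⟨_, finrank_sup_of_ne hxy, rfl⟩, γ, hγ, rfl⟩,
        ⟨hxL, Ne.symm hne.1⟩, ⟨hyL, Ne.symm hne.2⟩⟩
  rw [hset, Nat.card_coe_set_eq, Set.InjOn.ncard_image, Set.ncard_sdiff (by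
    rintro z (rfl | rfl) <;> assumption), Set.ncard_pair hxy,
    ncard_pgPointsIn_of_finrank_eq_two (finrank_sup_of_ne hxy)]
  · omega
  · intro γ hγ δ _ h
    by_contra hne
    exact ((Set.ext_iff.mp h γ).mpr ⟨hγ.1, hne⟩).2 rfl

/-- Point-deleted lines over a field with `q` elements have `q` points. -/
theorem card_of_mem_pgConsBlocks {K : Type*} [Field K] [Finite K] {n : ℕ}
    {B : Set (PGPoint K n)} (hB : B ∈ pgConsBlocks K n) : Nat.card B = Nat.card K := by
  obtain ⟨s, ⟨W, hW, rfl⟩, γ, hγ, rfl⟩ := hB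
  rw [Nat.card_coe_set_eq, Set.ncard_sdiff_singleton_of_mem hγ,
    ncard_pgPointsIn_of_finrank_eq_two hW, Nat.add_sub_cancel]

/-- Counting the pairs of distinct points in blocks of a `2`-design in two ways. -/
theorem IsTwoDesign.card_mul_eq {v k lam : ℕ} {P : Type*} [Finite P] {Bs : Set (Set P)}
    (h : IsTwoDesign v k lam P Bs) :
    (v * v - v) * lam = Nat.card Bs * (k * k - k) := by
  classical
  obtain ⟨hv, hk, hlam⟩ := h
  have := Fintype.ofFinite P
  have hcount := Finset.card_mul_eq_card_mul
    (s := (Finset.univ : Finset P).offDiag) (t := Bs.toFinset)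
    (fun p B => p.1 ∈ B ∧ p.2 ∈ B) (m := lam) (n := k * k - k) ?_ ?_
  · rwa [Finset.offDiag_card, Finset.card_univ, ← Nat.card_eq_fintype_card, hv,
      Set.toFinset_card, ← Nat.card_eq_fintype_card] at hcount
  · rintro ⟨x, y⟩ hp
    rw [← hlam x y (by simpa using hp), Nat.card_coe_set_eq, ← Set.ncard_coe_finset]
    congr 1
    ext B
    simp [Finset.bipartiteAbove]
  · intro B hB
    have hB' := hk B (by simpa using hB)
    rw [Nat.card_eq_fintype_card, ← Set.toFinset_card] at hB'
    rw [← hB', ← Finset.offDiag_card]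
    congr 1
    ext ⟨x, y⟩
    simp only [Finset.bipartiteBelow, Finset.mem_filter, Finset.mem_offDiag, Set.mem_toFinset,
      Finset.mem_univ, true_and]
    tauto

/-- The special linear group maps point-deleted lines to point-deleted lines. -/
theorem isAutomGroup_pgSL (K : Type*) [Field K] (n : ℕ) :
    IsAutomGroup (pgSL K n).range (pgConsBlocks K n) := by
  rintro g hg _ ⟨_, ⟨W, hW, rfl⟩, γ, hγ, rfl⟩
  obtain ⟨W', hW', himg⟩ := pgSL_image_pgPointsIn hg W
  refine ⟨_, ⟨W', hW'.trans hW, rfl⟩, g γ, himg ▸ Set.mem_image_of_mem g hγ, ?_⟩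
  rw [Set.image_sdiff g.injective, himg, Set.image_singleton]

/-- The special linear group is transitive on the flags formed by a point and a point-deleted
line containing it. -/
theorem isFlagTransitive_pgSL (K : Type*) [Field K] (n : ℕ) :
    IsFlagTransitive (pgSL K n).range (pgConsBlocks K n) := by
  rintro _ ⟨_, ⟨W₁, hW₁, rfl⟩, γ₁, hγ₁, rfl⟩ _ ⟨_, ⟨W₂, hW₂, rfl⟩, γ₂, hγ₂, rfl⟩ x₁ hx₁ x₂ hx₂
  obtain ⟨g, hg, hgx, hgγ⟩ := exists_pgSL_map_pair (a := x₁) (b := γ₁) (c := x₂) (d := γ₂)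
    hx₁.2 hx₂.2
  obtain ⟨W', hW', himg⟩ := pgSL_image_pgPointsIn hg W₁
  have hx' : x₂ ∈ pgPointsIn K n W' := himg ▸ hgx ▸ Set.mem_image_of_mem g hx₁.1
  have hγ' : γ₂ ∈ pgPointsIn K n W' := himg ▸ hgγ ▸ Set.mem_image_of_mem g hγ₁
  have hWW : W' = W₂ := (eq_sup_of_ne hx₂.2 (hW'.trans hW₁) hx' hγ').trans
    (eq_sup_of_ne hx₂.2 hW₂ hx₂.1 hγ₂).symm
  refine ⟨g, hg, ?_, hgx⟩
  rw [Set.image_sdiff g.injective, himg, Set.image_singleton, hgγ, hWW]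

/-- A `2`-transitive permutation group is primitive. -/
theorem isPointPrimitive_of_two_transitive {P : Type*} {G : Subgroup (Equiv.Perm P)}
    (h : ∀ a b c d : P, a ≠ b → c ≠ d → ∃ g ∈ G, g a = c ∧ g b = d) : IsPointPrimitive G := by
  refine ⟨fun x y => ?_, fun C ⟨⟨hne, hpart⟩, hinv⟩ => ?_⟩
  · by_cases hxy : x = y
    · exact ⟨1, G.one_mem, hxy⟩
    · obtain ⟨g, hg, hgx, -⟩ := h x y y x hxy (Ne.symm hxy)
      exact ⟨g, hg, hgx⟩
  · by_contra! hcon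
    obtain ⟨⟨Δ, hΔ, x, hx, y, hy, hxy⟩, hC⟩ := hcon
    have huniv : Δ = Set.univ := by
      refine Set.eq_univ_of_forall fun z => ?_
      by_cases hzx : z = x
      · exact hzx ▸ hx
      obtain ⟨g, hg, hgx, hgy⟩ := h x y x z hxy (Ne.symm hzx)
      have := (hpart x).unique ⟨hinv g hg Δ hΔ, x, hx, hgx⟩ ⟨hΔ, hx⟩
      exact this ▸ ⟨y, hy, hgy⟩
    subst huniv
    refine hC (Set.eq_singleton_iff_unique_mem.mpr ⟨hΔ, fun Δ' hΔ' => ?_⟩)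
    obtain ⟨z, hz⟩ := hne Δ' hΔ'
    exact (hpart z).unique ⟨hΔ', hz⟩ ⟨hΔ, Set.mem_univ z⟩

/-- Proposition 4.1(iii): for `n ≥ 3`, removing one point from each line of
`PG(n-1, 3)` yields a nontrivial non-symmetric `2`-`((3^n-1)/2, 3, 2)` design, and the
natural image of `PSL(n, 3)` in the symmetric group on the points is a flag-transitive,
point-primitive group of automorphisms of this design. -/
theorem pg3_construction_design (n : ℕ) (hn : 3 ≤ n) :
    IsTwoDesign ((3 ^ n - 1) / 2) 3 2 (PGPoint (ZMod 3) n) (pgConsBlocks (ZMod 3) n) ∧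
    3 < (3 ^ n - 1) / 2 ∧
    Nat.card (pgConsBlocks (ZMod 3) n) ≠ (3 ^ n - 1) / 2 ∧
    IsAutomGroup (pgSL (ZMod 3) n).range (pgConsBlocks (ZMod 3) n) ∧
    IsFlagTransitive (pgSL (ZMod 3) n).range (pgConsBlocks (ZMod 3) n) ∧
    IsPointPrimitive (pgSL (ZMod 3) n).range := by
  have hdesign : IsTwoDesign ((3 ^ n - 1) / 2) 3 2 (PGPoint (ZMod 3) n)
      (pgConsBlocks (ZMod 3) n) := by
    refine ⟨card_pgPoint_three n, fun B hB => ?_, fun x y hxy => ?_⟩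
    · simpa using card_of_mem_pgConsBlocks hB
    · simpa using card_pgConsBlocks_through hxy
  have hv : 13 ≤ (3 ^ n - 1) / 2 := by
    have : 3 ^ 3 ≤ 3 ^ n := Nat.pow_le_pow_right (by norm_num) hn
    omega
  refine ⟨hdesign, by omega, fun hb => ?_, isAutomGroup_pgSL _ n, isFlagTransitive_pgSL _ n,
    isPointPrimitive_of_two_transitive fun _ _ _ _ => exists_pgSL_map_pair⟩
  have hcount := hdesign.card_mul_eq
  rw [hb] at hcount
  generalize (3 ^ n - 1) / 2 = v at hv hcount
  have : v * 13 ≤ v * v := Nat.mul_le_mul_left v hv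
  omega
end

section
/- Let n ≥ 3 and let q be a prime power. Let D = (P,ℬ) be a nontrivial 2-(v,k,2) design whose point set P is the set of points of PG(n−1,q), and suppose G ≤ Aut(D) is flag-transitive, point-primitive on P, and contains the natural image of PSL(n,q) in Sym(P). Then either (a) q = 3, k = 3 and ℬ = { ℓ∖{γ} : ℓ a line of PG(n−1,3), γ ∈ ℓ }, or (b) n = 3, q = 2, k = 4 and ℬ = { P∖ℓ : ℓ a line of PG(2,2) } (the complement of the Fano plane). -/
/-- The complements of the lines of `PG(n-1, K)`. -/
def pgComplBlocks (K : Type*) [Field K] (n : ℕ) : Set (Set (PGPoint K n)) :=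
  {B | ∃ s ∈ pgLines K n, B = Set.univ \ s}


variable {K : Type*} [Field K] {n : ℕ}

/-- The vector `s` spans a point of `B`. -/
def PGMem (B : Set (PGPoint K n)) (s : Fin n → K) : Prop :=
  ∃ x ∈ B, x.1 = Submodule.span K {s}

theorem PGPoint.exists_rep (x : PGPoint K n) : ∃ s ≠ 0, x.1 = Submodule.span K {s} := by
  obtain ⟨v, hv, h⟩ := finrank_eq_one_iff'.1 x.2
  refine ⟨v, by simpa using hv, le_antisymm (fun s hs => ?_) ?_⟩
  · obtain ⟨c, hc⟩ := h ⟨s, hs⟩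
    exact Submodule.mem_span_singleton.2 ⟨c, congrArg Subtype.val hc⟩
  · exact (Submodule.span_singleton_le_iff_mem _ _).2 v.2

theorem PGMem.ne_zero {B : Set (PGPoint K n)} {s : Fin n → K} (h : PGMem B s) : s ≠ 0 := by
  rintro rfl
  obtain ⟨x, -, hx⟩ := h
  have hx1 := x.2
  rw [hx, Submodule.span_zero_singleton, finrank_bot] at hx1
  exact zero_ne_one hx1

theorem pgMem_smul {B : Set (PGPoint K n)} {c : K} (hc : c ≠ 0) (s : Fin n → K) :
    PGMem B (c • s) ↔ PGMem B s := by
  unfold PGMem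
  rw [Submodule.span_singleton_smul_eq hc.isUnit]

theorem pgMem_iff_of_eq {B : Set (PGPoint K n)} {x : PGPoint K n} {s : Fin n → K}
    (h : x.1 = Submodule.span K {s}) : PGMem B s ↔ x ∈ B := by
  refine ⟨fun ⟨y, hy, hys⟩ => ?_, fun hx => ⟨x, hx, h⟩⟩
  rwa [Subtype.ext (h.trans hys.symm)]

theorem pgMem_ext {B C : Set (PGPoint K n)} (h : ∀ s, PGMem B s ↔ PGMem C s) : B = C := by
  ext x
  obtain ⟨s, -, hs⟩ := x.exists_rep
  rw [← pgMem_iff_of_eq hs, ← pgMem_iff_of_eq hs, h]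

/-- The point spanned by a nonzero vector. -/
def pgMk (s : Fin n → K) (hs : s ≠ 0) : PGPoint K n :=
  ⟨Submodule.span K {s}, finrank_span_singleton hs⟩

theorem pgMem_iff {B : Set (PGPoint K n)} {s : Fin n → K} (hs : s ≠ 0) :
    PGMem B s ↔ pgMk s hs ∈ B :=
  pgMem_iff_of_eq (x := pgMk s hs) rfl

theorem pgSL_val (A : Matrix.SpecialLinearGroup (Fin n) K) (x : PGPoint K n) :
    (pgSL K n A x).1 = x.1.map (Matrix.toLin' A.1) := rfl

theorem pgMem_image (A : Matrix.SpecialLinearGroup (Fin n) K) {B : Set (PGPoint K n)}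
    {s t : Fin n → K} (h : Matrix.toLin' A.1 s = t) :
    PGMem (pgSL K n A '' B) t ↔ PGMem B s := by
  subst h
  by_cases hs : s = 0
  · subst hs
    rw [map_zero]
    exact ⟨fun h => absurd rfl h.ne_zero, fun h => absurd rfl h.ne_zero⟩
  have hx : (pgSL K n A (pgMk s hs)).1 = Submodule.span K {Matrix.toLin' A.1 s} := by
    rw [pgSL_val, pgMk, Submodule.map_span, Set.image_singleton]
  rw [pgMem_iff_of_eq hx, pgMem_iff hs, (pgSL K n A).injective.mem_set_image]

/-- A unimodular substitution of a linearly independent family extends to an element of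
`SL(n, K)`. -/
theorem exists_specialLinearGroup {m : ℕ} {v : Fin m → Fin n → K}
    (hv : LinearIndependent K v) (M : Matrix (Fin m) (Fin m) K) (hM : M.det = 1) :
    ∃ A : Matrix.SpecialLinearGroup (Fin n) K,
      ∀ i, Matrix.toLin' A.1 (v i) = ∑ j, M i j • v j := by
  classical
  let b := Module.Basis.sumExtend hv
  have : Finite (Fin m ⊕ Module.Basis.sumExtendIndex hv) := Module.Finite.finite_basis b
  have : Finite (Module.Basis.sumExtendIndex hv) :=
    Finite.of_injective (Sum.inr (α := Fin m)) Sum.inr_injective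
  have := Fintype.ofFinite (Module.Basis.sumExtendIndex hv)
  have hb : ∀ i, b (Sum.inl i) = v i := fun i => by
    simp only [b, Module.Basis.sumExtend, Module.Basis.reindex_apply,
      Module.Basis.extend_apply_self]
    rfl
  let N : Matrix (Fin m ⊕ Module.Basis.sumExtendIndex hv) (Fin m ⊕ Module.Basis.sumExtendIndex hv)
      K := Matrix.fromBlocks M.transpose 0 0 1
  refine ⟨⟨LinearMap.toMatrix' (Matrix.toLin b b N), ?_⟩, fun i => ?_⟩
  · rw [LinearMap.det_toMatrix', LinearMap.det_toLin]
    simp [N, hM]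
  · rw [Matrix.toLin'_toMatrix', ← hb, Matrix.toLin_self]
    simp [N, Fintype.sum_sum_type, hb]

theorem linearIndependent_pair_iff_span_ne {u w : Fin n → K} (hu : u ≠ 0) (hw : w ≠ 0) :
    LinearIndependent K ![u, w] ↔ Submodule.span K {u} ≠ Submodule.span K {w} := by
  rw [LinearIndependent.pair_iff' hu]
  refine ⟨fun h e => ?_, fun h a e => h ?_⟩
  · obtain ⟨a, ha⟩ := Submodule.mem_span_singleton.1
      (e ▸ Submodule.mem_span_singleton_self w : w ∈ Submodule.span K {u})
    exact h a ha
  · have ha : a ≠ 0 := by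
      rintro rfl
      exact hw (by rw [← e, zero_smul])
    rw [← e, Submodule.span_singleton_smul_eq ha.isUnit]

theorem linearIndependent_triple_iff {u v w : Fin n → K} :
    LinearIndependent K ![u, v, w] ↔
      ∀ a b c : K, a • u + b • v + c • w = 0 → a = 0 ∧ b = 0 ∧ c = 0 := by
  rw [Fintype.linearIndependent_iff]
  refine ⟨fun h a b c e => ?_, fun h g e i => ?_⟩
  · have := h ![a, b, c] (by simpa [Fin.sum_univ_three] using e)
    exact ⟨this 0, this 1, this 2⟩
  · obtain ⟨h0, h1, h2⟩ := h (g 0) (g 1) (g 2) (by simpa [Fin.sum_univ_three] using e)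
    fin_cases i <;> assumption

theorem linearIndependent_triple_iff_pair {r u w : Fin n → K} :
    LinearIndependent K ![r, u, w] ↔
      LinearIndependent K ![u, w] ∧ ∀ a b : K, r ≠ a • u + b • w := by
  refine linearIndependent_finCons.trans (and_congr_right fun _ => ?_)
  have : Set.range ![u, w] = {u, w} := by simp [Set.pair_comm]
  simp only [this, Submodule.mem_span_pair, not_exists, ne_eq, eq_comm]

theorem linearIndependent_quadruple_iff_triple {s r u w : Fin n → K} :
    LinearIndependent K ![s, r, u, w] ↔
      LinearIndependent K ![r, u, w] ∧ ∀ a b c : K, s ≠ a • r + b • u + c • w := by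
  refine linearIndependent_finCons.trans (and_congr_right fun _ => ?_)
  have : Set.range ![r, u, w] = {r, u, w} := by
    ext x
    simp only [Matrix.range_cons, Matrix.range_empty, Set.mem_union, Set.mem_singleton_iff,
      Set.mem_insert_iff, Set.mem_empty_iff_false, or_false]
  simp only [this, Submodule.mem_span_triple, not_exists, ne_eq, eq_comm]

theorem exists_linearIndependent_cons {m : ℕ} (hm : m < n) {v : Fin m → Fin n → K}
    (hv : LinearIndependent K v) :
    ∃ s : Fin n → K, LinearIndependent K (Matrix.vecCons s v) := by
  obtain ⟨s, hs⟩ := exists_linearIndependent_cons_of_lt_finrank hv (by simpa using hm)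
  exact ⟨s, hs⟩

theorem span_triple_eq_top (hn : n = 3) {r u w : Fin n → K}
    (h : LinearIndependent K ![r, u, w]) (s : Fin n → K) :
    ∃ a b c : K, s = a • r + b • u + c • w := by
  by_contra! hs
  have := (linearIndependent_quadruple_iff_triple.2 ⟨h, hs⟩).fintype_card_le_finrank
  simp [hn] at this

theorem apply_apply_of_ncard_eq_two {α : Type*} {E : Set α} (hE : E.ncard = 2) {f : α → α}
    (hf : Set.MapsTo f E E) (hi : f.Injective) {x : α} (hx : x ∈ E) : f (f x) = x := by
  obtain ⟨a, b, hab, rfl⟩ := Set.ncard_eq_two.1 hE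
  have ha := hf (Set.mem_insert a {b})
  have hb := hf (Set.mem_insert_of_mem a rfl)
  have := hi.ne hab
  simp only [Set.mem_insert_iff, Set.mem_singleton_iff] at *
  grind

theorem apply_comm_of_ncard_eq_two {α : Type*} {E : Set α} (hE : E.ncard = 2) {f g : α → α}
    (hf : Set.MapsTo f E E) (hg : Set.MapsTo g E E) (hfi : f.Injective) (hgi : g.Injective)
    {x : α} (hx : x ∈ E) : f (g x) = g (f x) := by
  obtain ⟨a, b, hab, rfl⟩ := Set.ncard_eq_two.1 hE
  have ha := hf (Set.mem_insert a {b})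
  have hb := hf (Set.mem_insert_of_mem a rfl)
  have ha' := hg (Set.mem_insert a {b})
  have hb' := hg (Set.mem_insert_of_mem a rfl)
  have := hfi.ne hab
  have := hgi.ne hab
  simp only [Set.mem_insert_iff, Set.mem_singleton_iff] at *
  grind

/-- A nontrivial biplane-like design (`lam = 2`) on the points of `PG(n-1, K)` with constant block
size `k`, invariant under `SL(n, K)`. -/
structure IsSLDesign (n k : ℕ) (Bs : Set (Set (PGPoint K n))) : Prop where
  two_lt : 2 < k
  ncard_block : ∀ B ∈ Bs, B.ncard = k
  ne_univ : ∀ B ∈ Bs, B ≠ Set.univ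
  ncard_pair : ∀ x y : PGPoint K n, x ≠ y → {B | B ∈ Bs ∧ x ∈ B ∧ y ∈ B}.ncard = 2
  image_mem : ∀ A, ∀ B ∈ Bs, pgSL K n A '' B ∈ Bs

/-- The blocks through the points spanned by `u` and `w`. -/
def blocksThrough (Bs : Set (Set (PGPoint K n))) (u w : Fin n → K) : Set (Set (PGPoint K n)) :=
  {B | B ∈ Bs ∧ PGMem B u ∧ PGMem B w}

namespace IsSLDesign

variable {k : ℕ} {Bs : Set (Set (PGPoint K n))} {B : Set (PGPoint K n)} {r r' s u w : Fin n → K}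

theorem ncard_blocksThrough (h : IsSLDesign n k Bs) (huw : LinearIndependent K ![u, w]) :
    (blocksThrough Bs u w).ncard = 2 := by
  have hu : u ≠ 0 := huw.ne_zero 0
  have hw : w ≠ 0 := huw.ne_zero 1
  rw [← h.ncard_pair (pgMk u hu) (pgMk w hw)]
  · congr 1
    ext B
    simp [blocksThrough, pgMem_iff hu, pgMem_iff hw]
  · exact fun e => (linearIndependent_pair_iff_span_ne hu hw).1 huw (congrArg Subtype.val e)

theorem mapsTo_blocksThrough (h : IsSLDesign n k Bs) {A : Matrix.SpecialLinearGroup (Fin n) K}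
    {a b : K} (ha : a ≠ 0) (hb : b ≠ 0) (hu : Matrix.toLin' A.1 u = a • u)
    (hw : Matrix.toLin' A.1 w = b • w) :
    Set.MapsTo (Set.image (pgSL K n A)) (blocksThrough Bs u w) (blocksThrough Bs u w) := by
  rintro B ⟨hB, hBu, hBw⟩
  refine ⟨h.image_mem A B hB, ?_, ?_⟩
  · rwa [← pgMem_smul ha, pgMem_image A hu]
  · rwa [← pgMem_smul hb, pgMem_image A hw]

theorem image_injective (A : Matrix.SpecialLinearGroup (Fin n) K) :
    (Set.image (pgSL K n A)).Injective :=
  Set.image_injective.2 (pgSL K n A).injective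

theorem pgMem_of_sq (h : IsSLDesign n k Bs) (huw : LinearIndependent K ![u, w])
    (hB : B ∈ blocksThrough Bs u w) {A : Matrix.SpecialLinearGroup (Fin n) K}
    (hu : Matrix.toLin' A.1 u = u) (hw : Matrix.toLin' A.1 w = w) (hs : PGMem B s) :
    PGMem B (Matrix.toLin' A.1 (Matrix.toLin' A.1 s)) := by
  have hm := h.mapsTo_blocksThrough (u := u) (w := w) (A := A) one_ne_zero one_ne_zero
    (by rwa [one_smul]) (by rwa [one_smul])
  rw [← apply_apply_of_ncard_eq_two (h.ncard_blocksThrough huw) hm (image_injective A) hB]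
  rwa [pgMem_image A rfl, pgMem_image A rfl]

theorem pgMem_of_comm (h : IsSLDesign n k Bs) (huw : LinearIndependent K ![u, w])
    (hB : B ∈ blocksThrough Bs u w) {A C : Matrix.SpecialLinearGroup (Fin n) K} {a b : K}
    (ha : a ≠ 0) (hb : b ≠ 0)
    (hAu : Matrix.toLin' A.1 u = a • u) (hAw : Matrix.toLin' A.1 w = b • w)
    (hCu : Matrix.toLin' C.1 u = u) (hCw : Matrix.toLin' C.1 w = w)
    (hAC : Matrix.toLin' A.1 (Matrix.toLin' C.1 r) = Matrix.toLin' C.1 (Matrix.toLin' A.1 s))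
    (hr : PGMem B r) : PGMem B s := by
  have hmA := h.mapsTo_blocksThrough ha hb hAu hAw
  have hmC := h.mapsTo_blocksThrough (u := u) (w := w) (A := C) one_ne_zero one_ne_zero
    (by rwa [one_smul]) (by rwa [one_smul])
  rw [← pgMem_image C rfl, ← pgMem_image A rfl] at hr
  rw [← pgMem_image A rfl, ← pgMem_image C rfl, ← hAC]
  rwa [apply_comm_of_ncard_eq_two (h.ncard_blocksThrough huw) hmC hmA (image_injective C)
    (image_injective A) hB]

theorem pgMem_of_quadruple (h : IsSLDesign n k Bs) (hB : B ∈ blocksThrough Bs u w)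
    (hli : LinearIndependent K ![r', r, u, w]) (hr : PGMem B r) : PGMem B r' := by
  have huw := (linearIndependent_triple_iff_pair.1
    (linearIndependent_quadruple_iff_triple.1 hli).1).1
  obtain ⟨A, hA⟩ := exists_specialLinearGroup hli
    !![0, -1, 0, 0; 1, 1, 0, 0; 0, 0, 1, 0; 0, 0, 0, 1]
    (by simp [Matrix.det_succ_row_zero, Fin.sum_univ_succ]; rfl)
  have h0 : Matrix.toLin' A.1 r' = -r := by simpa [Fin.sum_univ_four] using hA 0
  have h1 : Matrix.toLin' A.1 r = r' + r := by simpa [Fin.sum_univ_four] using hA 1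
  have h2 : Matrix.toLin' A.1 u = u := by simpa [Fin.sum_univ_four] using hA 2
  have h3 : Matrix.toLin' A.1 w = w := by simpa [Fin.sum_univ_four] using hA 3
  have := h.pgMem_of_sq huw hB h2 h3 hr
  rwa [h1, map_add, h0, h1, neg_add_eq_sub, add_sub_cancel_right] at this

theorem pgMem_add_smul (h : IsSLDesign n k Bs) (hB : B ∈ blocksThrough Bs u w)
    (hli : LinearIndependent K ![r, u, w]) {e : K} (he : e ≠ 0) (he1 : e ≠ 1) (c : K)
    (hr : PGMem B r) : PGMem B (r + c • u) := by
  have huw := (linearIndependent_triple_iff_pair.1 hli).1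
  have he1' : e - 1 ≠ 0 := sub_ne_zero.2 he1
  obtain ⟨A, hA⟩ := exists_specialLinearGroup hli !![1, 0, 0; 0, e, 0; 0, 0, e⁻¹]
    (by simp [Matrix.det_fin_three, he])
  obtain ⟨C, hC⟩ := exists_specialLinearGroup hli !![1, c * e / (e - 1), 0; 0, 1, 0; 0, 0, 1]
    (by simp [Matrix.det_fin_three])
  have hA0 : Matrix.toLin' A.1 r = r := by simpa [Fin.sum_univ_three] using hA 0
  have hA1 : Matrix.toLin' A.1 u = e • u := by simpa [Fin.sum_univ_three] using hA 1
  have hA2 : Matrix.toLin' A.1 w = e⁻¹ • w := by simpa [Fin.sum_univ_three] using hA 2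
  have hC0 : Matrix.toLin' C.1 r = r + (c * e / (e - 1)) • u := by
    simpa [Fin.sum_univ_three] using hC 0
  have hC1 : Matrix.toLin' C.1 u = u := by simpa [Fin.sum_univ_three] using hC 1
  have hC2 : Matrix.toLin' C.1 w = w := by simpa [Fin.sum_univ_three] using hC 2
  refine h.pgMem_of_comm huw hB he (inv_ne_zero he) hA1 hA2 hC1 hC2 ?_ hr
  simp only [hC0, hC1, map_add, map_smul, hA0, hA1]
  rw [add_assoc, smul_smul, smul_smul, ← add_smul]
  congr 2
  field_simp
  ring

theorem mem_blocksThrough_swap (hB : B ∈ blocksThrough Bs u w) : B ∈ blocksThrough Bs w u :=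
  ⟨hB.1, hB.2.2, hB.2.1⟩

theorem pgMem_of_linearIndependent (h : IsSLDesign n k Bs)
    (hK : 4 ≤ n ∨ ∃ e : K, e ≠ 0 ∧ e ≠ 1) (hB : B ∈ blocksThrough Bs u w)
    (hr : LinearIndependent K ![r, u, w]) (hr' : LinearIndependent K ![r', u, w])
    (hrB : PGMem B r) : PGMem B r' := by
  by_cases hli : LinearIndependent K ![r', r, u, w]
  · exact h.pgMem_of_quadruple hB hli hrB
  have hr'2 := linearIndependent_triple_iff_pair.1 hr'
  obtain ⟨a, b, c, habc⟩ : ∃ a b c : K, r' = a • r + b • u + c • w := by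
    by_contra! hne
    exact hli (linearIndependent_quadruple_iff_triple.2 ⟨hr, hne⟩)
  have ha : a ≠ 0 := by
    rintro rfl
    exact hr'2.2 b c (by rw [habc, zero_smul, zero_add])
  by_cases hn4 : 4 ≤ n
  · obtain ⟨s, hs⟩ := exists_linearIndependent_cons (show 3 < n from hn4) hr
    have hs2 := (linearIndependent_quadruple_iff_triple.1 hs).2
    refine h.pgMem_of_quadruple hB ?_ (h.pgMem_of_quadruple hB hs hrB)
    refine linearIndependent_quadruple_iff_triple.2 ⟨?_, fun x y z e => ?_⟩
    · refine linearIndependent_triple_iff_pair.2 ⟨hr'2.1, fun y z e => hs2 0 y z ?_⟩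
      rw [e, zero_smul, zero_add]
    · have hx : x ≠ 0 := by
        rintro rfl
        exact hr'2.2 y z (by rw [e, zero_smul, zero_add])
      refine hs2 (x⁻¹ * a) (x⁻¹ * (b - y)) (x⁻¹ * (c - z)) ?_
      have : x • s = a • r + (b - y) • u + (c - z) • w := by
        have hxs : x • s = r' - y • u - z • w := by rw [e]; abel
        rw [hxs, habc]
        module
      rw [mul_smul, mul_smul, mul_smul, ← smul_add, ← smul_add, ← this, inv_smul_smul₀ hx]
  · obtain ⟨e, he, he1⟩ := hK.resolve_left hn4
    have h1 := h.pgMem_add_smul hB hr he he1 (a⁻¹ * b) hrB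
    have h2 := h.pgMem_add_smul (mem_blocksThrough_swap hB) (r := r + (a⁻¹ * b) • u) ?_ he he1
      (a⁻¹ * c) h1
    · rw [habc, ← pgMem_smul (inv_ne_zero ha)]
      convert h2 using 1
      simp only [smul_add, smul_smul, inv_mul_cancel₀ ha, one_smul]
    · rw [linearIndependent_triple_iff] at hr ⊢
      intro x y z hxyz
      obtain ⟨hx, hz, hy⟩ := hr x (x * (a⁻¹ * b) + z) y (by rw [← hxyz]; module)
      subst hx
      simpa [hy] using hz

theorem exists_eq_of_pgMem (h : IsSLDesign n k Bs)
    (hK : 4 ≤ n ∨ ∃ e : K, e ≠ 0 ∧ e ≠ 1) (huw : LinearIndependent K ![u, w])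
    (hB : B ∈ blocksThrough Bs u w) (hr : PGMem B r) : ∃ a b : K, r = a • u + b • w := by
  by_contra! hne
  have hli : LinearIndependent K ![r, u, w] := linearIndependent_triple_iff_pair.2 ⟨huw, hne⟩
  refine h.ne_univ B hB.1 (Set.eq_univ_of_forall fun x => ?_)
  obtain ⟨s, hs0, hs⟩ := x.exists_rep
  rw [← pgMem_iff_of_eq hs]
  by_cases hsuw : LinearIndependent K ![s, u, w]
  · exact h.pgMem_of_linearIndependent hK hB hli hsuw hr
  obtain ⟨a, b, rfl⟩ : ∃ a b : K, s = a • u + b • w := by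
    by_contra! hne'
    exact hsuw (linearIndependent_triple_iff_pair.2 ⟨huw, hne'⟩)
  by_cases hb : b = 0
  · subst hb
    rw [zero_smul, add_zero] at hs0 ⊢
    exact (pgMem_smul (fun ha => hs0 (by rw [ha, zero_smul])) u).2 hB.2.1
  have hli' := linearIndependent_triple_iff.1 hli
  refine h.pgMem_of_linearIndependent (u := u) (w := r) (r := w) hK ⟨hB.1, hB.2.1, hr⟩ ?_ ?_
    hB.2.2
  · refine linearIndependent_triple_iff.2 fun x y z e => ?_
    obtain ⟨h1, h2, h3⟩ := hli' z y x (by rw [← e]; module)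
    exact ⟨h3, h2, h1⟩
  · refine linearIndependent_triple_iff.2 fun x y z e => ?_
    obtain ⟨h1, h2, h3⟩ := hli' z (x * a + y) (x * b) (by rw [← e]; module)
    have hx : x = 0 := (mul_eq_zero.1 h3).resolve_right hb
    subst hx
    exact ⟨rfl, by simpa using h2, h1⟩

/-- `SL(n, K)` is transitive on the points of a line other than two given ones. -/
theorem exists_image_iff (h : IsSLDesign n k Bs) (hn : 3 ≤ n)
    (huw : LinearIndependent K ![u, w]) {a b c d : K} (ha : a ≠ 0) (hb : b ≠ 0) (hc : c ≠ 0)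
    (hd : d ≠ 0) :
    ∃ f : Set (PGPoint K n) → Set (PGPoint K n), f.Injective ∧
      Set.MapsTo f (blocksThrough Bs u w) (blocksThrough Bs u w) ∧
      ∀ B, PGMem (f B) (c • u + d • w) ↔ PGMem B (a • u + b • w) := by
  obtain ⟨r, hli⟩ := exists_linearIndependent_cons (show 2 < n from hn) huw
  obtain ⟨A, hA⟩ := exists_specialLinearGroup hli
    !![(a / c) * (b / d), 0, 0; 0, c / a, 0; 0, 0, d / b]
    (by simp [Matrix.det_fin_three]; field_simp)
  have hA1 : Matrix.toLin' A.1 u = (c / a) • u := by simpa [Fin.sum_univ_three] using hA 1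
  have hA2 : Matrix.toLin' A.1 w = (d / b) • w := by simpa [Fin.sum_univ_three] using hA 2
  refine ⟨Set.image (pgSL K n A), image_injective A, h.mapsTo_blocksThrough (div_ne_zero hc ha)
    (div_ne_zero hd hb) hA1 hA2, fun B => pgMem_image A ?_⟩
  rw [map_add, map_smul, map_smul, hA1, hA2, smul_smul, smul_smul, mul_div_cancel₀ _ ha,
    mul_div_cancel₀ _ hb]

theorem exists_pgMem_of_pgMem (h : IsSLDesign n k Bs) (huw : LinearIndependent K ![u, w])
    (hB : B ∈ blocksThrough Bs u w) :
    ∃ s, PGMem B s ∧ LinearIndependent K ![u, s] ∧ LinearIndependent K ![w, s] := by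
  have hu : u ≠ 0 := huw.ne_zero 0
  have hw : w ≠ 0 := huw.ne_zero 1
  have hlt : ({pgMk u hu, pgMk w hw} : Set (PGPoint K n)).ncard < B.ncard := by
    rw [h.ncard_block B hB.1]
    exact (Set.ncard_insert_le _ _).trans_lt (by simpa using h.two_lt)
  obtain ⟨x, hxB, hx⟩ := Set.exists_mem_notMem_of_ncard_lt_ncard hlt (Set.toFinite _)
  obtain ⟨s, hs0, hs⟩ := x.exists_rep
  refine ⟨s, (pgMem_iff_of_eq hs).2 hxB, ?_, ?_⟩
  · refine (linearIndependent_pair_iff_span_ne hu hs0).2 fun e => hx (Or.inl (Subtype.ext ?_))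
    rw [hs, ← e]
    rfl
  · refine (linearIndependent_pair_iff_span_ne hw hs0).2 fun e => hx (Or.inr (Subtype.ext ?_))
    rw [hs, ← e]
    rfl

section Line

variable {B₁ B₂ : Set (PGPoint K n)} {a b c d : K}

theorem exists_ne_zero_pgMem (h : IsSLDesign n k Bs)
    (hK : 4 ≤ n ∨ ∃ e : K, e ≠ 0 ∧ e ≠ 1) (huw : LinearIndependent K ![u, w])
    (hB : B ∈ blocksThrough Bs u w) :
    ∃ a b : K, a ≠ 0 ∧ b ≠ 0 ∧ PGMem B (a • u + b • w) := by
  obtain ⟨s, hs, hus, hws⟩ := h.exists_pgMem_of_pgMem huw hB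
  obtain ⟨a, b, rfl⟩ := h.exists_eq_of_pgMem hK huw hB hs
  refine ⟨a, b, ?_, ?_, hs⟩
  · rintro rfl
    exact (LinearIndependent.pair_iff' (hws.ne_zero 0)).1 hws b (by simp)
  · rintro rfl
    exact (LinearIndependent.pair_iff' (hus.ne_zero 0)).1 hus a (by simp)

theorem subset_of_forall (h : IsSLDesign n k Bs)
    (hK : 4 ≤ n ∨ ∃ e : K, e ≠ 0 ∧ e ≠ 1) (huw : LinearIndependent K ![u, w])
    (h₁ : B₁ ∈ blocksThrough Bs u w) (h₂ : B₂ ∈ blocksThrough Bs u w)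
    (H : ∀ c d : K, c ≠ 0 → d ≠ 0 → PGMem B₂ (c • u + d • w)) (hs : PGMem B₁ s) :
    PGMem B₂ s := by
  obtain ⟨c, d, rfl⟩ := h.exists_eq_of_pgMem hK huw h₁ hs
  have hs0 := hs.ne_zero
  by_cases hc : c = 0
  · have hd : d ≠ 0 := by
      rintro rfl
      simp [hc] at hs0
    rw [hc, zero_smul, zero_add, pgMem_smul hd]
    exact h₂.2.2
  by_cases hd : d = 0
  · rw [hd, zero_smul, add_zero, pgMem_smul hc]
    exact h₂.2.1
  · exact H c d hc hd

theorem pgMem_iff_not_pgMem (h : IsSLDesign n k Bs) (hn : 3 ≤ n)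
    (hK : 4 ≤ n ∨ ∃ e : K, e ≠ 0 ∧ e ≠ 1) (huw : LinearIndependent K ![u, w])
    (h₁ : B₁ ∈ blocksThrough Bs u w) (h₂ : B₂ ∈ blocksThrough Bs u w) (hne : B₁ ≠ B₂)
    (ha : a ≠ 0) (hb : b ≠ 0) :
    PGMem B₁ (a • u + b • w) ↔ ¬ PGMem B₂ (a • u + b • w) := by
  have hE := h.ncard_blocksThrough huw
  have hcases : ∀ B ∈ blocksThrough Bs u w, B = B₁ ∨ B = B₂ := by
    obtain ⟨C, D, -, hCD⟩ := Set.ncard_eq_two.1 hE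
    simp only [hCD, Set.mem_insert_iff, Set.mem_singleton_iff] at *
    grind
  refine ⟨fun hB₁ hB₂ => hne ?_, fun hB₂ => ?_⟩
  · have H : ∀ B ∈ blocksThrough Bs u w, ∀ c d : K, c ≠ 0 → d ≠ 0 →
        PGMem B (c • u + d • w) := by
      intro B hB c d hc hd
      obtain ⟨f, hfi, hfE, hf⟩ := h.exists_image_iff hn huw ha hb hc hd
      rw [← apply_apply_of_ncard_eq_two hE hfE hfi hB, hf]
      rcases hcases _ (hfE hB) with e | e <;> rw [e] <;> assumption
    exact pgMem_ext fun s => ⟨h.subset_of_forall hK huw h₁ h₂ (H B₂ h₂),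
      h.subset_of_forall hK huw h₂ h₁ (H B₁ h₁)⟩
  · by_contra hB₁
    obtain ⟨c, d, hc, hd, hcd⟩ := h.exists_ne_zero_pgMem hK huw h₁
    obtain ⟨f, hfi, hfE, hf⟩ := h.exists_image_iff hn huw hc hd ha hb
    rw [← hf] at hcd
    rcases hcases _ (hfE h₁) with e | e <;> rw [e] at hcd <;> contradiction

theorem exists_other (h : IsSLDesign n k Bs) (huw : LinearIndependent K ![u, w])
    (B : Set (PGPoint K n)) : ∃ C ∈ blocksThrough Bs u w, C ≠ B :=
  Set.exists_ne_of_one_lt_ncard (by rw [h.ncard_blocksThrough huw]; norm_num) B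

theorem eq_or_eq_or_eq (h : IsSLDesign n k Bs) (huw : LinearIndependent K ![u, w])
    {B₃ : Set (PGPoint K n)} (h₁ : B₁ ∈ blocksThrough Bs u w) (h₂ : B₂ ∈ blocksThrough Bs u w)
    (h₃ : B₃ ∈ blocksThrough Bs u w) : B₁ = B₂ ∨ B₁ = B₃ ∨ B₂ = B₃ := by
  obtain ⟨C, D, -, hCD⟩ := Set.ncard_eq_two.1 (h.ncard_blocksThrough huw)
  simp only [hCD, Set.mem_insert_iff, Set.mem_singleton_iff] at *
  grind

theorem linearIndependent_add_smul (huw : LinearIndependent K ![u, w]) (hc : c ≠ 0) :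
    LinearIndependent K ![u, u + c • w] := by
  rw [LinearIndependent.pair_iff] at huw ⊢
  intro x y e
  obtain ⟨h1, h2⟩ := huw (x + y) (y * c) (by rw [← e]; module)
  have hy : y = 0 := (mul_eq_zero.1 h2).resolve_right hc
  subst hy
  exact ⟨by simpa using h1, rfl⟩

theorem pgMem_iff_not_pgMem_shift (h : IsSLDesign n k Bs) (hn : 3 ≤ n)
    (hK : 4 ≤ n ∨ ∃ e : K, e ≠ 0 ∧ e ≠ 1) (huw : LinearIndependent K ![u, w])
    (hc : c ≠ 0) (hd : d ≠ 0) (hcd : c ≠ d)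
    (h₁ : B₁ ∈ blocksThrough Bs u (u + c • w)) (h₂ : B₂ ∈ blocksThrough Bs u (u + c • w))
    (hne : B₁ ≠ B₂) : PGMem B₁ (u + d • w) ↔ ¬ PGMem B₂ (u + d • w) := by
  have h1 : (1 - d / c) ≠ 0 := by
    rw [sub_ne_zero, ne_comm, Ne, div_eq_one_iff_eq hc]
    exact hcd.symm
  have := h.pgMem_iff_not_pgMem hn hK (linearIndependent_add_smul huw hc) h₁ h₂ hne h1
    (div_ne_zero hd hc)
  have e : (1 - d / c) • u + (d / c) • (u + c • w) = u + d • w := by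
    rw [smul_add, smul_smul, div_mul_cancel₀ _ hc]
    module
  rwa [e] at this

theorem eq_of_pgMem (h : IsSLDesign n k Bs) (hn : 3 ≤ n)
    (hK : 4 ≤ n ∨ ∃ e : K, e ≠ 0 ∧ e ≠ 1) (huw : LinearIndependent K ![u, w])
    (h₁ : B₁ ∈ blocksThrough Bs u w) (hc : c ≠ 0) (hd : d ≠ 0)
    (hcB : PGMem B₁ (u + c • w)) (hdB : PGMem B₁ (u + d • w)) : c = d := by
  by_contra hcd
  obtain ⟨B₂, h₂, hne⟩ := h.exists_other huw B₁
  have key : ∀ e : K, e ≠ 0 → (PGMem B₁ (u + e • w) ↔ ¬ PGMem B₂ (u + e • w)) := fun e he => by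
    simpa using h.pgMem_iff_not_pgMem hn hK huw h₁ h₂ hne.symm one_ne_zero he
  obtain ⟨x, y, hx, hy, hxy⟩ := h.exists_ne_zero_pgMem hK huw h₂
  obtain ⟨e, he, heB⟩ : ∃ e : K, e ≠ 0 ∧ PGMem B₂ (u + e • w) := by
    refine ⟨x⁻¹ * y, mul_ne_zero (inv_ne_zero hx) hy, ?_⟩
    rwa [← pgMem_smul hx, smul_add, smul_smul, mul_inv_cancel_left₀ hx]
  have heB₁ : ¬ PGMem B₁ (u + e • w) := fun H => (key e he).1 H heB
  have hce : c ≠ e := by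
    rintro rfl
    exact heB₁ hcB
  have hde : d ≠ e := by
    rintro rfl
    exact heB₁ hdB
  obtain ⟨B₃, h₃, hne₃⟩ := h.exists_other (linearIndependent_add_smul huw hc) B₁
  obtain ⟨B₄, h₄, hne₄⟩ := h.exists_other (linearIndependent_add_smul huw hd) B₁
  have he₃ : PGMem B₃ (u + e • w) := (h.pgMem_iff_not_pgMem_shift hn hK huw hc he hce h₃
    ⟨h₁.1, h₁.2.1, hcB⟩ hne₃).2 heB₁
  have he₄ : PGMem B₄ (u + e • w) := (h.pgMem_iff_not_pgMem_shift hn hK huw hd he hde h₄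
    ⟨h₁.1, h₁.2.1, hdB⟩ hne₄).2 heB₁
  rcases h.eq_or_eq_or_eq (linearIndependent_add_smul huw he) ⟨h₂.1, h₂.2.1, heB⟩
    ⟨h₃.1, h₃.2.1, he₃⟩ ⟨h₄.1, h₄.2.1, he₄⟩ with E | E | E
  · exact (key c hc).1 hcB (E ▸ h₃.2.2)
  · exact (key d hd).1 hdB (E ▸ h₄.2.2)
  · exact (h.pgMem_iff_not_pgMem_shift hn hK huw hc hd hcd h₃ ⟨h₁.1, h₁.2.1, hcB⟩ hne₃).1
      (E ▸ h₄.2.2) hdB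

/-- The blocks through two points are their line with one further point removed, and the line
has four points. -/
theorem exists_params (h : IsSLDesign n k Bs) (hn : 3 ≤ n)
    (hK : 4 ≤ n ∨ ∃ e : K, e ≠ 0 ∧ e ≠ 1) (huw : LinearIndependent K ![u, w])
    (h₁ : B₁ ∈ blocksThrough Bs u w) :
    ∃ c d : K, c ≠ 0 ∧ d ≠ 0 ∧ c ≠ d ∧ (∀ x : K, x = 0 ∨ x = c ∨ x = d) ∧
      PGMem B₁ (u + c • w) ∧ ¬ PGMem B₁ (u + d • w) := by
  obtain ⟨B₂, h₂, hne⟩ := h.exists_other huw B₁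
  have key : ∀ e : K, e ≠ 0 → (PGMem B₁ (u + e • w) ↔ ¬ PGMem B₂ (u + e • w)) := fun e he => by
    simpa using h.pgMem_iff_not_pgMem hn hK huw h₁ h₂ hne.symm one_ne_zero he
  have hex : ∀ B ∈ blocksThrough Bs u w, ∃ e : K, e ≠ 0 ∧ PGMem B (u + e • w) := by
    intro B hB
    obtain ⟨x, y, hx, hy, hxy⟩ := h.exists_ne_zero_pgMem hK huw hB
    refine ⟨x⁻¹ * y, mul_ne_zero (inv_ne_zero hx) hy, ?_⟩
    rwa [← pgMem_smul hx, smul_add, smul_smul, mul_inv_cancel_left₀ hx]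
  obtain ⟨c, hc, hcB⟩ := hex B₁ h₁
  obtain ⟨d, hd, hdB⟩ := hex B₂ h₂
  have hdB₁ : ¬ PGMem B₁ (u + d • w) := fun H => (key d hd).1 H hdB
  refine ⟨c, d, hc, hd, ?_, fun x => ?_, hcB, hdB₁⟩
  · rintro rfl
    exact hdB₁ hcB
  · by_cases hx : x = 0
    · exact Or.inl hx
    by_cases hxB : PGMem B₁ (u + x • w)
    · exact Or.inr (Or.inl (h.eq_of_pgMem hn hK huw h₁ hx hc hxB hcB))
    · exact Or.inr (Or.inr (h.eq_of_pgMem hn hK huw h₂ hx hd (by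
        by_contra H
        exact hxB ((key x hx).2 H)) hdB))

end Line

theorem exists_linearIndependent (h : IsSLDesign n k Bs) (hB : B ∈ Bs) :
    ∃ u w : Fin n → K, LinearIndependent K ![u, w] ∧ B ∈ blocksThrough Bs u w := by
  have hc : 1 < B.ncard := by
    rw [h.ncard_block B hB]
    exact one_lt_two.trans h.two_lt
  obtain ⟨x, hx, y, hy, hxy⟩ := (Set.one_lt_ncard (Set.finite_of_ncard_pos (by omega))).1 hc
  obtain ⟨u, hu0, hu⟩ := x.exists_rep
  obtain ⟨w, hw0, hw⟩ := y.exists_rep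
  refine ⟨u, w, (linearIndependent_pair_iff_span_ne hu0 hw0).2 ?_, hB,
    (pgMem_iff_of_eq hu).2 hx, (pgMem_iff_of_eq hw).2 hy⟩
  rw [← hu, ← hw]
  exact fun e => hxy (Subtype.ext e)

theorem finrank_span_pair (huw : LinearIndependent K ![u, w]) :
    Module.finrank K (Submodule.span K {u, w}) = 2 := by
  have : Set.range ![u, w] = {u, w} := by simp [Set.pair_comm]
  rw [← this, finrank_span_eq_card huw, Fintype.card_fin]

theorem exists_eq_span_pair {W : Submodule K (Fin n → K)} (hW : Module.finrank K W = 2)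
    (hu : u ∈ W) (hu0 : u ≠ 0) :
    ∃ w, LinearIndependent K ![u, w] ∧ W = Submodule.span K {u, w} := by
  obtain ⟨w, hwW, hw⟩ : ∃ w ∈ W, w ∉ Submodule.span K {u} := by
    by_contra! hle
    have := Submodule.finrank_mono (show W ≤ Submodule.span K {u} from hle)
    rw [hW, finrank_span_singleton hu0] at this
    omega
  have hli : LinearIndependent K ![u, w] := (LinearIndependent.pair_iff' hu0).2 fun a e =>
    hw (Submodule.mem_span_singleton.2 ⟨a, e⟩)
  refine ⟨w, hli, (Submodule.eq_of_le_of_finrank_eq ?_ ?_).symm⟩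
  · rw [Submodule.span_le, Set.insert_subset_iff, Set.singleton_subset_iff]
    exact ⟨hu, hwW⟩
  · rw [finrank_span_pair hli, hW]

theorem mem_pgPointsIn_iff {W : Submodule K (Fin n → K)} {x : PGPoint K n}
    (hs : x.1 = Submodule.span K {s}) : x ∈ pgPointsIn K n W ↔ s ∈ W := by
  rw [pgPointsIn, Set.mem_ofPred_eq, hs, Submodule.span_singleton_le_iff_mem]

theorem pgMk_ne_pgMk (huw : LinearIndependent K ![u, w]) (hu : u ≠ 0) (hw : w ≠ 0) :
    pgMk u hu ≠ pgMk w hw := fun e =>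
  (linearIndependent_pair_iff_span_ne hu hw).1 huw (congrArg Subtype.val e)

section ThreeElements

variable {c d : K}

theorem pgMem_pair_iff (h : IsSLDesign n k Bs) (hK : 4 ≤ n ∨ ∃ e : K, e ≠ 0 ∧ e ≠ 1)
    (huw : LinearIndependent K ![u, w]) (hB : B ∈ blocksThrough Bs u w)
    (hcd : ∀ x : K, x = 0 ∨ x = c ∨ x = d) (hc : PGMem B (u + c • w))
    (hd : ¬ PGMem B (u + d • w)) {s : Fin n → K} (hs : s ≠ 0) :
    (PGMem B s ↔ Submodule.span K {s} = Submodule.span K {u} ∨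
      Submodule.span K {s} = Submodule.span K {w} ∨
      Submodule.span K {s} = Submodule.span K {u + c • w}) ∧
    (PGMem B s ↔ s ∈ Submodule.span K {u, w} ∧
      Submodule.span K {s} ≠ Submodule.span K {u + d • w}) := by
  have hspan : ∀ {t : Fin n → K}, Submodule.span K {s} = Submodule.span K {t} →
      (PGMem B s ↔ PGMem B t) := fun e => by unfold PGMem; rw [e]
  have hmem : ∀ {t : Fin n → K}, Submodule.span K {s} = Submodule.span K {t} →
      t ∈ Submodule.span K {u, w} → s ∈ Submodule.span K {u, w} := fun {t} e ht => by
    rw [← Submodule.span_singleton_le_iff_mem] at ht ⊢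
    rwa [e]
  have hline : s ∈ Submodule.span K {u, w} →
      (Submodule.span K {s} = Submodule.span K {u} ∨
      Submodule.span K {s} = Submodule.span K {w} ∨
      Submodule.span K {s} = Submodule.span K {u + c • w}) ∨
      Submodule.span K {s} = Submodule.span K {u + d • w} := by
    rw [Submodule.mem_span_pair]
    rintro ⟨a, b, rfl⟩
    by_cases ha : a = 0
    · have hb : b ≠ 0 := by
        rintro rfl
        simp [ha] at hs
      rw [ha, zero_smul, zero_add, Submodule.span_singleton_smul_eq hb.isUnit]
      simp
    · have e : a • u + b • w = a • (u + (b / a) • w) := by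
        rw [smul_add, smul_smul, mul_div_cancel₀ _ ha]
      rw [e, Submodule.span_singleton_smul_eq (Ne.isUnit ha)]
      rcases hcd (b / a) with e | e | e <;> rw [e] <;> simp
  have hsub : PGMem B s → s ∈ Submodule.span K {u, w} := fun H => by
    obtain ⟨a, b, rfl⟩ := h.exists_eq_of_pgMem hK huw hB H
    exact Submodule.mem_span_pair.2 ⟨a, b, rfl⟩
  have hout : PGMem B s → Submodule.span K {s} ≠ Submodule.span K {u + d • w} :=
    fun H e => hd ((hspan e).1 H)
  have hin : (Submodule.span K {s} = Submodule.span K {u} ∨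
      Submodule.span K {s} = Submodule.span K {w} ∨
      Submodule.span K {s} = Submodule.span K {u + c • w}) → PGMem B s := by
    rintro (e | e | e)
    · exact (hspan e).2 hB.2.1
    · exact (hspan e).2 hB.2.2
    · exact (hspan e).2 hc
  exact ⟨⟨fun H => (hline (hsub H)).resolve_right (hout H), hin⟩,
    fun H => ⟨hsub H, hout H⟩, fun H => hin ((hline H.1).resolve_right H.2)⟩

theorem eq_three (h : IsSLDesign n k Bs) (hK : 4 ≤ n ∨ ∃ e : K, e ≠ 0 ∧ e ≠ 1)
    (huw : LinearIndependent K ![u, w]) (hB : B ∈ blocksThrough Bs u w) (hc0 : c ≠ 0)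
    (hcd : ∀ x : K, x = 0 ∨ x = c ∨ x = d) (hc : PGMem B (u + c • w))
    (hd : ¬ PGMem B (u + d • w)) : k = 3 := by
  have hu := hB.2.1.ne_zero
  have hw := hB.2.2.ne_zero
  have hcw := hc.ne_zero
  have hwc : LinearIndependent K ![w, u + c • w] := by
    rw [LinearIndependent.pair_iff] at huw ⊢
    intro x y e
    obtain ⟨rfl, h2⟩ := huw y (x + y * c) (by rw [← e]; module)
    exact ⟨by simpa using h2, rfl⟩
  rw [← h.ncard_block B hB.1, Set.ncard_eq_three]
  refine ⟨pgMk u hu, pgMk w hw, pgMk _ hcw, pgMk_ne_pgMk huw hu hw,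
    pgMk_ne_pgMk (linearIndependent_add_smul huw hc0) hu hcw, pgMk_ne_pgMk hwc hw hcw, ?_⟩
  ext x
  obtain ⟨s, hs0, hs⟩ := x.exists_rep
  rw [← pgMem_iff_of_eq hs, (h.pgMem_pair_iff hK huw hB hcd hc hd hs0).1]
  simp only [Set.mem_insert_iff, Set.mem_singleton_iff, Subtype.ext_iff, hs, pgMk]

theorem eq_diff (h : IsSLDesign n k Bs) (hK : 4 ≤ n ∨ ∃ e : K, e ≠ 0 ∧ e ≠ 1)
    (huw : LinearIndependent K ![u, w]) (hB : B ∈ blocksThrough Bs u w)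
    (hcd : ∀ x : K, x = 0 ∨ x = c ∨ x = d) (hc : PGMem B (u + c • w))
    (hd : ¬ PGMem B (u + d • w)) (hd0 : u + d • w ≠ 0) :
    B = pgPointsIn K n (Submodule.span K {u, w}) \ {pgMk (u + d • w) hd0} := by
  ext x
  obtain ⟨s, hs0, hs⟩ := x.exists_rep
  rw [← pgMem_iff_of_eq hs, (h.pgMem_pair_iff hK huw hB hcd hc hd hs0).2, Set.mem_sdiff,
    mem_pgPointsIn_iff hs, Set.mem_singleton_iff, Subtype.ext_iff, hs]
  rfl

theorem classification_of_line (h : IsSLDesign n k Bs) (hn : 3 ≤ n)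
    (hK : 4 ≤ n ∨ ∃ e : K, e ≠ 0 ∧ e ≠ 1) (hne : Bs.Nonempty) :
    Nat.card K = 3 ∧ k = 3 ∧ Bs = pgConsBlocks K n := by
  have main : ∀ B ∈ Bs, Nat.card K = 3 ∧ k = 3 ∧ B ∈ pgConsBlocks K n := by
    intro B hB
    obtain ⟨u, w, huw, hBuw⟩ := h.exists_linearIndependent hB
    obtain ⟨c, d, hc0, hd0, hne, hcd, hc, hd⟩ := h.exists_params hn hK huw hBuw
    have hdw : u + d • w ≠ 0 := (linearIndependent_add_smul huw hd0).ne_zero 1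
    refine ⟨?_, h.eq_three hK huw hBuw hc0 hcd hc hd, pgPointsIn K n (Submodule.span K {u, w}),
      ⟨_, finrank_span_pair huw, rfl⟩, pgMk _ hdw, ?_,
      h.eq_diff hK huw hBuw hcd hc hd hdw⟩
    · rw [← Set.ncard_univ, Set.ncard_eq_three]
      exact ⟨0, c, d, hc0.symm, hd0.symm, hne, by ext x; simpa using hcd x⟩
    · refine (mem_pgPointsIn_iff (s := u + d • w) rfl).2 (Submodule.mem_span_pair.2 ⟨1, d, ?_⟩)
      rw [one_smul]
  obtain ⟨B₀, hB₀⟩ := hne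
  refine ⟨(main B₀ hB₀).1, (main B₀ hB₀).2.1,
    Set.Subset.antisymm (fun B hB => (main B hB).2.2) ?_⟩
  rintro _ ⟨_, ⟨W, hW, rfl⟩, x, hxW, rfl⟩
  obtain ⟨g, hg0, hg⟩ := x.exists_rep
  obtain ⟨u, hgu, rfl⟩ := exists_eq_span_pair hW ((mem_pgPointsIn_iff hg).1 hxW) hg0
  have huw : LinearIndependent K ![u, g - u] := by
    rw [LinearIndependent.pair_iff] at hgu ⊢
    intro x y e
    obtain ⟨rfl, h2⟩ := hgu y (x - y) (by rw [← e]; module)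
    exact ⟨by simpa using h2, rfl⟩
  have hg1 : u + (1 : K) • (g - u) = g := by module
  obtain ⟨B, hB, hBg⟩ : ∃ B ∈ blocksThrough Bs u (g - u), ¬ PGMem B g := by
    obtain ⟨B₁, h₁⟩ := Set.nonempty_of_ncard_ne_zero
      (by rw [h.ncard_blocksThrough huw]; norm_num : (blocksThrough Bs u (g - u)).ncard ≠ 0)
    obtain ⟨B₂, h₂, hne⟩ := h.exists_other huw B₁
    have := h.pgMem_iff_not_pgMem hn hK huw h₁ h₂ hne.symm one_ne_zero one_ne_zero
    rw [one_smul, hg1] at this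
    by_cases hg2 : PGMem B₂ g
    · exact ⟨B₁, h₁, fun H => this.1 H hg2⟩
    · exact ⟨B₂, h₂, hg2⟩
  obtain ⟨c, d, hc0, hd0, hne, hcd, hc, hd⟩ := h.exists_params hn hK huw hB
  have hd1 : d = 1 := by
    rcases hcd 1 with e | e | e
    · exact absurd e one_ne_zero
    · rw [← e, hg1] at hc
      exact absurd hc hBg
    · exact e.symm
  subst hd1
  have hspan : Submodule.span K {g, u} = Submodule.span K {u, g - u} := by
    ext s
    simp only [Submodule.mem_span_pair]
    constructor
    · rintro ⟨a, b, rfl⟩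
      exact ⟨a + b, a, by module⟩
    · rintro ⟨a, b, rfl⟩
      exact ⟨b, a - b, by module⟩
  have hx : x = pgMk (u + (1 : K) • (g - u)) (by rwa [hg1]) := by
    rw [Subtype.ext_iff, hg, pgMk]
    simp only [hg1]
  rw [hspan, hx, ← h.eq_diff hK huw hB hcd hc hd]
  exact hB.1

end ThreeElements

section TwoElements

theorem add_self_of_zero_or_one (hK : ∀ a : K, a = 0 ∨ a = 1) (s : Fin n → K) : s + s = 0 := by
  have h1 : (1 : K) + 1 = 0 := (hK (1 + 1)).resolve_right (by simp)
  rw [← two_smul K, ← one_add_one_eq_two, h1, zero_smul]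

/-- Over the field with two elements, a block through `u` and `w` contains an even number of the
four points of a plane through `u` and `w` that lie off their line. -/
theorem parity (h : IsSLDesign n k Bs) (hK : ∀ a : K, a = 0 ∨ a = 1)
    (hB : B ∈ blocksThrough Bs u w) (hli : LinearIndependent K ![r, u, w]) :
    ((PGMem B r ↔ PGMem B (r + u)) ∧ (PGMem B (r + w) ↔ PGMem B (r + u + w))) ∨
    ((PGMem B r ↔ PGMem B (r + w)) ∧ (PGMem B (r + u) ↔ PGMem B (r + u + w))) ∨
    ((PGMem B r ↔ PGMem B (r + u + w)) ∧ (PGMem B (r + u) ↔ PGMem B (r + w))) := by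
  have huw := (linearIndependent_triple_iff_pair.1 hli).1
  obtain ⟨A, hA⟩ := exists_specialLinearGroup hli !![1, 1, 0; 0, 1, 0; 0, 0, 1]
    (by simp [Matrix.det_fin_three])
  obtain ⟨C, hC⟩ := exists_specialLinearGroup hli !![1, 0, 1; 0, 1, 0; 0, 0, 1]
    (by simp [Matrix.det_fin_three])
  have hA0 : Matrix.toLin' A.1 r = r + u := by simpa [Fin.sum_univ_three] using hA 0
  have hA1 : Matrix.toLin' A.1 u = u := by simpa [Fin.sum_univ_three] using hA 1
  have hA2 : Matrix.toLin' A.1 w = w := by simpa [Fin.sum_univ_three] using hA 2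
  have hC0 : Matrix.toLin' C.1 r = r + w := by simpa [Fin.sum_univ_three] using hC 0
  have hC1 : Matrix.toLin' C.1 u = u := by simpa [Fin.sum_univ_three] using hC 1
  have hC2 : Matrix.toLin' C.1 w = w := by simpa [Fin.sum_univ_three] using hC 2
  have hmA := h.mapsTo_blocksThrough (u := u) (w := w) (A := A) one_ne_zero one_ne_zero
    (by rwa [one_smul]) (by rwa [one_smul])
  have hmC := h.mapsTo_blocksThrough (u := u) (w := w) (A := C) one_ne_zero one_ne_zero
    (by rwa [one_smul]) (by rwa [one_smul])
  have hE := h.ncard_blocksThrough huw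
  by_cases hAB : pgSL K n A '' B = B
  · have key : ∀ {s t}, Matrix.toLin' A.1 s = t → (PGMem B s ↔ PGMem B t) := fun e => by
      rw [← pgMem_image A e, hAB]
    refine Or.inl ⟨key hA0, key ?_⟩
    rw [map_add, hA0, hA2]
  by_cases hCB : pgSL K n C '' B = B
  · have key : ∀ {s t}, Matrix.toLin' C.1 s = t → (PGMem B s ↔ PGMem B t) := fun e => by
      rw [← pgMem_image C e, hCB]
    refine Or.inr (Or.inl ⟨key hC0, key ?_⟩)
    rw [map_add, hC0, hC1, add_right_comm]
  · have hAC : pgSL K n A '' (pgSL K n C '' B) = B := by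
      have e : pgSL K n C '' B = pgSL K n A '' B := by
        rcases h.eq_or_eq_or_eq huw hB (hmA hB) (hmC hB) with e | e | e
        · exact absurd e.symm hAB
        · exact absurd e.symm hCB
        · exact e.symm
      rw [e]
      exact apply_apply_of_ncard_eq_two hE hmA (image_injective A) hB
    have key : ∀ {s t}, Matrix.toLin' A.1 (Matrix.toLin' C.1 s) = t →
        (PGMem B s ↔ PGMem B t) := fun {s t} e => by
      rw [← pgMem_image C (s := s) rfl, ← pgMem_image A e, hAC]
    refine Or.inr (Or.inr ⟨key ?_, key ?_⟩)
    · rw [hC0, map_add, hA0, hA2]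
    · rw [map_add, map_add, hC0, hC1, map_add, hA0, hA1, hA2, add_right_comm, add_assoc,
        add_assoc, ← add_assoc u u w, add_self_of_zero_or_one hK, zero_add]

theorem linearIndependent_triple_rotate (hli : LinearIndependent K ![r, u, w]) :
    LinearIndependent K ![u, w, r] := by
  rw [linearIndependent_triple_iff] at hli ⊢
  intro a b c e
  obtain ⟨h1, h2, h3⟩ := hli c a b (by rw [← e]; abel)
  exact ⟨h2, h3, h1⟩

theorem exists_eq_sum (hn : n = 3) (hK : ∀ a : K, a = 0 ∨ a = 1)
    (hli : LinearIndependent K ![r, u, w]) (hs : s ≠ 0) :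
    s = u ∨ s = w ∨ s = r ∨ s = r + u + w ∨ s = u + w ∨ s = r + u ∨ s = r + w := by
  obtain ⟨a, b, c, rfl⟩ := span_triple_eq_top hn hli s
  rcases hK a with rfl | rfl <;> rcases hK b with rfl | rfl <;> rcases hK c with rfl | rfl <;>
    simp_all

theorem pgMem_of_triple (h : IsSLDesign n k Bs) (hn : n = 3) (hK : ∀ a : K, a = 0 ∨ a = 1)
    (hB : B ∈ blocksThrough Bs u w) (hli : LinearIndependent K ![r, u, w]) (hr : PGMem B r) :
    PGMem B (r + u + w) ∧ ¬ PGMem B (u + w) ∧ ¬ PGMem B (r + u) ∧ ¬ PGMem B (r + w) := by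
  have hli' := linearIndependent_triple_rotate hli
  have h1 := h.parity hK hB hli
  have h2 := h.parity (u := w) (w := r) (r := u) hK ⟨hB.1, hB.2.2, hr⟩ hli'
  have h3 := h.parity (u := r) (w := u) (r := w) hK ⟨hB.1, hr, hB.2.1⟩
    (linearIndependent_triple_rotate hli')
  rw [add_comm u r, show u + w + r = r + u + w by abel] at h2
  rw [add_comm w r, add_comm w u, add_right_comm] at h3
  have hall : ¬ (PGMem B (r + u + w) ∧ PGMem B (u + w) ∧ PGMem B (r + u) ∧ PGMem B (r + w)) := by
    rintro ⟨p1, p2, p3, p4⟩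
    refine h.ne_univ B hB.1 (Set.eq_univ_of_forall fun x => ?_)
    obtain ⟨s, hs0, hs⟩ := x.exists_rep
    rw [← pgMem_iff_of_eq hs]
    rcases exists_eq_sum hn hK hli hs0 with rfl | rfl | rfl | rfl | rfl | rfl | rfl
    exacts [hB.2.1, hB.2.2, hr, p1, p2, p3, p4]
  have hu := hB.2.1
  have hw := hB.2.2
  simp only [hu, hw, hr, true_iff] at h1 h2 h3
  clear hB hli hli' hu hw hr h hn hK
  generalize PGMem B (r + u + w) = p1, PGMem B (u + w) = p2, PGMem B (r + u) = p3,
    PGMem B (r + w) = p4 at *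
  by_cases p1 <;> by_cases p2 <;> by_cases p3 <;> by_cases p4 <;> simp_all

theorem eq_four (h : IsSLDesign n k Bs) (hn : n = 3) (hK : ∀ a : K, a = 0 ∨ a = 1)
    (hB : B ∈ blocksThrough Bs u w) (hli : LinearIndependent K ![r, u, w]) (hr : PGMem B r) :
    k = 4 := by
  obtain ⟨h1, h2, h3, h4⟩ := h.pgMem_of_triple hn hK hB hli hr
  have hu := hB.2.1
  have hw := hB.2.2
  have hB4 : B = {pgMk u hu.ne_zero, pgMk w hw.ne_zero, pgMk r hr.ne_zero,
      pgMk (r + u + w) h1.ne_zero} := by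
    ext x
    constructor
    · intro hx
      obtain ⟨s, hs0, hs⟩ := x.exists_rep
      rw [← pgMem_iff_of_eq hs] at hx
      rcases exists_eq_sum hn hK hli hs0 with rfl | rfl | rfl | rfl | rfl | rfl | rfl
      · exact Or.inl (Subtype.ext hs)
      · exact Or.inr (Or.inl (Subtype.ext hs))
      · exact Or.inr (Or.inr (Or.inl (Subtype.ext hs)))
      · exact Or.inr (Or.inr (Or.inr (Subtype.ext hs)))
      all_goals contradiction
    · rintro (rfl | rfl | rfl | rfl)
      exacts [(pgMem_iff _).1 hu, (pgMem_iff _).1 hw, (pgMem_iff _).1 hr, (pgMem_iff _).1 h1]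
  rw [linearIndependent_triple_iff] at hli
  have p1 : LinearIndependent K ![u, w] := LinearIndependent.pair_iff.2 fun a b e =>
    (hli 0 a b (by rw [← e]; module)).2
  have p2 : LinearIndependent K ![u, r] := LinearIndependent.pair_iff.2 fun a b e =>
    have := hli b a 0 (by rw [← e]; module)
    ⟨this.2.1, this.1⟩
  have p3 : LinearIndependent K ![w, r] := LinearIndependent.pair_iff.2 fun a b e =>
    have := hli b 0 a (by rw [← e]; module)
    ⟨this.2.2, this.1⟩
  have p4 : LinearIndependent K ![u, r + u + w] := LinearIndependent.pair_iff.2 fun a b e => by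
    obtain ⟨rfl, h2, -⟩ := hli b (a + b) b (by rw [← e]; module)
    exact ⟨by simpa using h2, rfl⟩
  have p5 : LinearIndependent K ![w, r + u + w] := LinearIndependent.pair_iff.2 fun a b e => by
    obtain ⟨rfl, -, h2⟩ := hli b b (a + b) (by rw [← e]; module)
    exact ⟨by simpa using h2, rfl⟩
  have p6 : LinearIndependent K ![r, r + u + w] := LinearIndependent.pair_iff.2 fun a b e => by
    obtain ⟨h2, rfl, -⟩ := hli (a + b) b b (by rw [← e]; module)
    exact ⟨by simpa using h2, rfl⟩
  rw [← h.ncard_block B hB.1, hB4, Set.ncard_insert_of_notMem, Set.ncard_insert_of_notMem,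
    Set.ncard_pair (pgMk_ne_pgMk p6 _ _)]
  · simp only [Set.mem_insert_iff, Set.mem_singleton_iff, not_or]
    exact ⟨pgMk_ne_pgMk p3 _ _, pgMk_ne_pgMk p5 _ _⟩
  · simp only [Set.mem_insert_iff, Set.mem_singleton_iff, not_or]
    exact ⟨pgMk_ne_pgMk p1 _ _, pgMk_ne_pgMk p2 _ _, pgMk_ne_pgMk p4 _ _⟩

theorem exists_pgMem_triple (h : IsSLDesign n k Bs) (hn : n = 3) (hK : ∀ a : K, a = 0 ∨ a = 1)
    (huw : LinearIndependent K ![u, w]) (hB : B ∈ blocksThrough Bs u w) :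
    ∃ r, LinearIndependent K ![r, u, w] ∧ PGMem B r := by
  have huw0 : u + w ≠ 0 := fun e => by
    simpa using (LinearIndependent.pair_iff.1 huw 1 1 (by rw [← e]; module)).1
  have hsub : ∀ C ∈ blocksThrough Bs u w, (¬ ∃ r, LinearIndependent K ![r, u, w] ∧ PGMem C r) →
      C = {pgMk u hB.2.1.ne_zero, pgMk w hB.2.2.ne_zero, pgMk (u + w) huw0} := by
    intro C hC hne
    refine Set.eq_of_subset_of_ncard_le (fun x hx => ?_) ?_ (Set.toFinite _)
    · obtain ⟨s, hs0, hs⟩ := x.exists_rep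
      have hsC := (pgMem_iff_of_eq hs).2 hx
      obtain ⟨a, b, rfl⟩ : ∃ a b : K, s = a • u + b • w := by
        by_contra! H
        exact hne ⟨s, linearIndependent_triple_iff_pair.2 ⟨huw, H⟩, hsC⟩
      rcases hK a with rfl | rfl <;> rcases hK b with rfl | rfl <;>
        simp only [zero_smul, one_smul, add_zero, zero_add] at hs hs0
      · exact absurd rfl hs0
      · exact Or.inr (Or.inl (Subtype.ext hs))
      · exact Or.inl (Subtype.ext hs)
      · exact Or.inr (Or.inr (Subtype.ext hs))
    · rw [h.ncard_block C hC.1]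
      refine le_trans ?_ h.two_lt
      refine (Set.ncard_insert_le _ _).trans (Nat.succ_le_succ ?_)
      exact (Set.ncard_insert_le _ _).trans (by simp)
  by_contra hne
  obtain ⟨C, hC, hCB⟩ := h.exists_other huw B
  by_cases hC' : ∃ r, LinearIndependent K ![r, u, w] ∧ PGMem C r
  · obtain ⟨r, hr, hrC⟩ := hC'
    have hk := h.eq_four hn hK hC hr hrC
    rw [← h.ncard_block B hB.1, hsub B hB hne] at hk
    have h1 := Set.ncard_insert_le (pgMk u hB.2.1.ne_zero)
      {pgMk w hB.2.2.ne_zero, pgMk (u + w) huw0}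
    have h2 := Set.ncard_insert_le (pgMk w hB.2.2.ne_zero) {pgMk (u + w) huw0}
    rw [Set.ncard_singleton] at h2
    omega
  · exact hCB ((hsub C hC hC').trans (hsub B hB hne).symm)

theorem eq_compl (h : IsSLDesign n k Bs) (hn : n = 3) (hK : ∀ a : K, a = 0 ∨ a = 1)
    (hB : B ∈ blocksThrough Bs u w) (hli : LinearIndependent K ![r, u, w]) (hr : PGMem B r) :
    B = Set.univ \ pgPointsIn K n (Submodule.span K {u + w, r + u}) := by
  have h2 : (1 : K) + 1 = 0 := (hK (1 + 1)).resolve_right (by simp)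
  obtain ⟨p1, p2, p3, p4⟩ := h.pgMem_of_triple hn hK hB hli hr
  have hmem : ∀ a b c : K,
      a • r + b • u + c • w ∈ Submodule.span K {u + w, r + u} ↔ b = a + c := by
    intro a b c
    rw [Submodule.mem_span_pair]
    constructor
    · rintro ⟨x, y, e⟩
      obtain ⟨h1, h2, h3⟩ := linearIndependent_triple_iff.1 hli (a - y) (b - x - y) (c - x)
        (by rw [← sub_eq_zero.2 e.symm]; module)
      linear_combination h2 - h1 - h3
    · rintro rfl
      exact ⟨c, a, by module⟩
  ext x
  obtain ⟨s, hs0, hs⟩ := x.exists_rep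
  rw [← pgMem_iff_of_eq hs, Set.mem_sdiff, mem_pgPointsIn_iff hs]
  obtain ⟨a, b, c, rfl⟩ := span_triple_eq_top hn hli s
  rw [hmem]
  have hu := hB.2.1
  have hw := hB.2.2
  rcases hK a with rfl | rfl <;> rcases hK b with rfl | rfl <;> rcases hK c with rfl | rfl <;>
    simp_all

theorem exists_block_of_triple (h : IsSLDesign n k Bs) (hn : n = 3)
    (hK : ∀ a : K, a = 0 ∨ a = 1) (hli : LinearIndependent K ![r, u, w]) :
    ∃ B ∈ blocksThrough Bs u w, PGMem B r := by
  have hrp := linearIndependent_triple_iff_pair.1 hli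
  obtain ⟨B, hB⟩ := Set.nonempty_of_ncard_ne_zero
    (by rw [h.ncard_blocksThrough hrp.1]; norm_num : (blocksThrough Bs u w).ncard ≠ 0)
  obtain ⟨t, ht, htB⟩ := h.exists_pgMem_triple hn hK hrp.1 hB
  obtain ⟨a, b, c, e⟩ := span_triple_eq_top hn ht r
  have ha : a = 1 := (hK a).resolve_left fun ha => hrp.2 b c (by rw [e, ha, zero_smul, zero_add])
  obtain ⟨A, hA⟩ := exists_specialLinearGroup ht !![1, b, c; 0, 1, 0; 0, 0, 1]
    (by simp [Matrix.det_fin_three])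
  have hA0 : Matrix.toLin' A.1 t = r := by
    rw [e, ha]
    simpa [Fin.sum_univ_three, add_assoc] using hA 0
  have hA1 : Matrix.toLin' A.1 u = u := by simpa [Fin.sum_univ_three] using hA 1
  have hA2 : Matrix.toLin' A.1 w = w := by simpa [Fin.sum_univ_three] using hA 2
  exact ⟨pgSL K n A '' B, ⟨h.image_mem A B hB.1, (pgMem_image A hA1).2 hB.2.1,
    (pgMem_image A hA2).2 hB.2.2⟩, (pgMem_image A hA0).2 htB⟩

theorem classification_of_two (h : IsSLDesign n k Bs) (hn : n = 3)
    (hK : ∀ a : K, a = 0 ∨ a = 1) (hne : Bs.Nonempty) :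
    k = 4 ∧ Bs = pgComplBlocks K n := by
  have main : ∀ B ∈ Bs, k = 4 ∧ B ∈ pgComplBlocks K n := by
    intro B hB
    obtain ⟨u, w, huw, hBuw⟩ := h.exists_linearIndependent hB
    obtain ⟨r, hli, hr⟩ := h.exists_pgMem_triple hn hK huw hBuw
    refine ⟨h.eq_four hn hK hBuw hli hr, _, ⟨_, finrank_span_pair ?_, rfl⟩,
      h.eq_compl hn hK hBuw hli hr⟩
    rw [LinearIndependent.pair_iff]
    intro x y e
    obtain ⟨h1, -, h3⟩ := linearIndependent_triple_iff.1 hli y (x + y) x (by rw [← e]; module)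
    exact ⟨h3, h1⟩
  obtain ⟨B₀, hB₀⟩ := hne
  refine ⟨(main B₀ hB₀).1, Set.Subset.antisymm (fun B hB => (main B hB).2) ?_⟩
  rintro _ ⟨_, ⟨W, hW, rfl⟩, rfl⟩
  have : Nontrivial W := Module.nontrivial_of_finrank_pos (R := K) (by omega)
  obtain ⟨⟨g, hgW⟩, hg0⟩ := exists_ne (0 : W)
  obtain ⟨t, hgt, rfl⟩ := exists_eq_span_pair hW hgW (by simpa using hg0)
  obtain ⟨v, hv⟩ := exists_linearIndependent_cons (show 2 < n by omega) hgt
  have hli : LinearIndependent K ![v + t, v, v + g] := by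
    have hv := linearIndependent_triple_iff.1 hv
    refine linearIndependent_triple_iff.2 fun a b c e => ?_
    obtain ⟨h1, rfl, rfl⟩ := hv (a + b + c) c a (by rw [← e]; module)
    exact ⟨rfl, by simpa using h1, rfl⟩
  obtain ⟨B, hB, hr⟩ := h.exists_block_of_triple hn hK hli
  have hadd := add_self_of_zero_or_one (n := n) hK v
  have := h.eq_compl hn hK hB hli hr
  rw [← add_assoc, hadd, zero_add, add_right_comm, hadd, zero_add] at this
  rw [← this]
  exact hB.1

end TwoElements

end IsSLDesign

/-- The classification of invariant designs over an arbitrary field `K`. -/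
theorem isSLDesign_classification {k : ℕ} {Bs : Set (Set (PGPoint K n))} (h : IsSLDesign n k Bs)
    (hn : 3 ≤ n) (hne : Bs.Nonempty) :
    (Nat.card K = 3 ∧ k = 3 ∧ Bs = pgConsBlocks K n) ∨
    (n = 3 ∧ Nat.card K = 2 ∧ k = 4 ∧ Bs = pgComplBlocks K n) := by
  by_cases hK : 4 ≤ n ∨ ∃ e : K, e ≠ 0 ∧ e ≠ 1
  · exact Or.inl (h.classification_of_line hn hK hne)
  · push Not at hK
    have h01 : ∀ a : K, a = 0 ∨ a = 1 := fun a => or_iff_not_imp_left.2 (hK.2 a)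
    have hn3 : n = 3 := by omega
    refine Or.inr ⟨hn3, ?_, h.classification_of_two hn3 h01 hne⟩
    rw [← Set.ncard_univ, Set.ncard_eq_two]
    exact ⟨0, 1, zero_ne_one, by ext x; simpa using h01 x⟩

/-- Proposition 4.2: let `D` be a nontrivial `2`-`(v, k, 2)` design whose points are the
points of `PG(n-1, q)` with `n ≥ 3` and `q = p^f`, and let `G` be a flag-transitive,
point-primitive group of automorphisms containing the natural image of `PSL(n, q)`.
Then either `q = 3`, `k = 3` and the blocks are the lines minus a point, or
`n = 3`, `q = 2`, `k = 4` and the blocks are the complements of the lines (the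
complement of the Fano plane). -/
theorem natural_projective_action_classification (n p f : ℕ) (hn : 3 ≤ n)
    [hp : Fact p.Prime] (hf : 0 < f) (v k : ℕ)
    (Bs : Set (Set (PGPoint (GaloisField p f) n)))
    (hD : IsTwoDesign v k 2 (PGPoint (GaloisField p f) n) Bs)
    (hk : 2 < k) (hkv : k < v)
    (G : Subgroup (Equiv.Perm (PGPoint (GaloisField p f) n)))
    (hGaut : IsAutomGroup G Bs) (hft : IsFlagTransitive G Bs)
    (hprim : IsPointPrimitive G)
    (hPSL : (pgSL (GaloisField p f) n).range ≤ G) :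
    (p ^ f = 3 ∧ k = 3 ∧ Bs = pgConsBlocks (GaloisField p f) n) ∨
    (n = 3 ∧ p ^ f = 2 ∧ k = 4 ∧ Bs = pgComplBlocks (GaloisField p f) n) := by
  have hv : 0 < Nat.card (PGPoint (GaloisField p f) n) := by rw [hD.1]; omega
  have hfin : Finite (PGPoint (GaloisField p f) n) := (Nat.card_pos_iff.1 hv).2
  have h : IsSLDesign n k Bs :=
    { two_lt := hk
      ncard_block := fun B hB => by rw [← Nat.card_coe_set_eq, hD.2.1 B hB]
      ne_univ := by
        rintro B hB rfl
        have := hD.2.1 _ hB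
        rw [Nat.card_coe_set_eq, Set.ncard_univ, hD.1] at this
        omega
      ncard_pair := fun x y hxy => by rw [← hD.2.2 x y hxy, Nat.card_coe_set_eq]
      image_mem := fun A B hB => hGaut _ (hPSL ⟨A, rfl⟩) B hB }
  have : Nontrivial (PGPoint (GaloisField p f) n) :=
    Finite.one_lt_card_iff_nontrivial.1 (by rw [hD.1]; omega)
  obtain ⟨x, y, hxy⟩ := exists_pair_ne (PGPoint (GaloisField p f) n)
  obtain ⟨B, hB, -⟩ := Set.nonempty_of_ncard_ne_zero
    (by rw [h.ncard_pair x y hxy]; norm_num : {B | B ∈ Bs ∧ x ∈ B ∧ y ∈ B}.ncard ≠ 0)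
  rw [← GaloisField.card p f hf.ne']
  exact isSLDesign_classification h hn ⟨B, hB⟩
end
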